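/- arXiv:0710.4375 — 2 statements merged into one kernel-verified Lean document; each statement's English description precedes it below -/
import Mathlib

section
/- Let Δ ⊂ ℝ^n (n ≥ 1) be the convex hull of a finite subset of ℤ^n with nonempty interior, φ_Δ(v) = log(Σ_{α ∈ Δ∩ℤ^n} e^{⟨α,v⟩}), χ : ℝ^n → ℝ smooth with compact support, φ = φ_Δ + χ, and φ_e the convex envelope of φ. With Λ_k and N_{k,p} as in the toric Bergman setup, the functions u_k(v) = k^{−1} log( Σ_{p ∈ Λ_k} e^{k⟨p,v⟩} / N_{k,p} ) converge to φ_e uniformly on every compact subset of ℝ^n as k → ∞. (This is the toric-model instance of the theorem that the Bergman metrics k^{−1} log K_k(x,x) converge uniformly to the equilibrium metric φ_e on compact subsets of X − B₊(L).) -/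
open scoped RealInnerProductSpace
open MeasureTheory Filter

/-- The convex envelope of a function `φ : ℝⁿ → ℝ`: the pointwise supremum of all
convex minorants of `φ`. -/
noncomputable def convEnv {n : ℕ} (φ : EuclideanSpace ℝ (Fin n) → ℝ)
    (v : EuclideanSpace ℝ (Fin n)) : ℝ :=
  sSup {y : ℝ | ∃ g : EuclideanSpace ℝ (Fin n) → ℝ,
    ConvexOn ℝ Set.univ g ∧ (∀ w, g w ≤ φ w) ∧ y = g v}


section LSE
variable {n : ℕ}

noncomputable def lseZ (A : Finset (EuclideanSpace ℝ (Fin n))) (w : EuclideanSpace ℝ (Fin n)) : ℝ :=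
  ∑ α ∈ A, Real.exp ⟪α, w⟫

noncomputable def lseV (A : Finset (EuclideanSpace ℝ (Fin n))) (w : EuclideanSpace ℝ (Fin n)) :
    EuclideanSpace ℝ (Fin n) := ∑ α ∈ A, Real.exp ⟪α, w⟫ • α

noncomputable def lseG (A : Finset (EuclideanSpace ℝ (Fin n))) (w : EuclideanSpace ℝ (Fin n)) :
    EuclideanSpace ℝ (Fin n) := (lseZ A w)⁻¹ • lseV A w

variable {A : Finset (EuclideanSpace ℝ (Fin n))}

lemma lseZ_pos (hA : A.Nonempty) (w : EuclideanSpace ℝ (Fin n)) : 0 < lseZ A w :=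
  Finset.sum_pos (fun _ _ => Real.exp_pos _) hA

lemma hasFDerivAt_lseZ (w : EuclideanSpace ℝ (Fin n)) :
    HasFDerivAt (lseZ A) (∑ α ∈ A, Real.exp ⟪α, w⟫ • innerSL ℝ α) w := by
  unfold lseZ
  refine HasFDerivAt.fun_sum fun α _ => ?_
  exact ((innerSL ℝ α).hasFDerivAt (x := w)).exp

lemma hasFDerivAt_lseV (w : EuclideanSpace ℝ (Fin n)) :
    HasFDerivAt (lseV A) (∑ α ∈ A, (Real.exp ⟪α, w⟫ • innerSL ℝ α).smulRight α) w := by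
  unfold lseV
  refine HasFDerivAt.fun_sum fun α _ => ?_
  exact (((innerSL ℝ α).hasFDerivAt (x := w)).exp).smul_const α

lemma contDiff_lseG (hA : A.Nonempty) : ContDiff ℝ 2 (lseG A) := by
  unfold lseG
  have h1 : ContDiff ℝ 2 (lseZ A) := by 
    unfold lseZ
    exact ContDiff.sum fun α _ => ((innerSL ℝ α).contDiff).exp
  have h2 : ContDiff ℝ 2 (lseV A) := by 
    unfold lseV
    exact ContDiff.sum fun α _ => ((innerSL ℝ α).contDiff.exp).smul contDiff_const
  exact (h1.inv (fun w => (lseZ_pos hA w).ne')).smul h2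

lemma gradient_lse (hA : A.Nonempty) :
    gradient (fun w => Real.log (∑ α ∈ A, Real.exp ⟪α, w⟫)) = lseG A := by
  funext w
  apply HasGradientAt.gradient
  rw [hasGradientAt_iff_hasFDerivAt]
  have := (hasFDerivAt_lseZ (A := A) w).log (lseZ_pos hA w).ne'
  refine HasFDerivAt.congr_fderiv this ?_
  ext d
  simp [lseG, lseV, Finset.mul_sum]

lemma inner_fderiv_lseG (hA : A.Nonempty) (w d e : EuclideanSpace ℝ (Fin n)) :
    ⟪fderiv ℝ (lseG A) w d, e⟫ =
      (lseZ A w)⁻¹ * ∑ α ∈ A, Real.exp ⟪α, w⟫ * ⟪α, d⟫ * ⟪α, e⟫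
      - (lseZ A w)⁻¹ ^ 2 * ((∑ α ∈ A, Real.exp ⟪α, w⟫ * ⟪α, d⟫) *
          (∑ α ∈ A, Real.exp ⟪α, w⟫ * ⟪α, e⟫)) := by
  have hZ := lseZ_pos hA w
  have h := ((hasDerivAt_inv hZ.ne').comp_hasFDerivAt w (hasFDerivAt_lseZ (A := A) w)).smul
    (hasFDerivAt_lseV (A := A) w)
  have h' : HasFDerivAt (lseG A) _ w := h
  rw [h'.fderiv]
  simp [lseV, inner_smul_left, sum_inner, inner_add_left, Finset.sum_mul, Finset.mul_sum]
  rw [← sub_eq_add_neg]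
  simp only [mul_assoc]

lemma inner_fderiv_lseG_pos (hA : A.Nonempty) (w d : EuclideanSpace ℝ (Fin n))
    (hd : ∀ c : ℝ, ∃ α ∈ A, ⟪α, d⟫ ≠ c) :
    0 < ⟪fderiv ℝ (lseG A) w d, d⟫ := by
  rw [inner_fderiv_lseG hA]
  have hZ := lseZ_pos hA w
  set Z := lseZ A w with hZd
  set M := ∑ α ∈ A, Real.exp ⟪α, w⟫ * ⟪α, d⟫ with hM
  have key : Z⁻¹ * ∑ α ∈ A, Real.exp ⟪α, w⟫ * ⟪α, d⟫ * ⟪α, d⟫ - Z⁻¹ ^ 2 * (M * M)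
      = Z⁻¹ * ∑ α ∈ A, Real.exp ⟪α, w⟫ * (⟪α, d⟫ - Z⁻¹ * M) ^ 2 := by
    have : ∑ α ∈ A, Real.exp ⟪α, w⟫ * (⟪α, d⟫ - Z⁻¹ * M) ^ 2
        = ∑ α ∈ A, Real.exp ⟪α, w⟫ * ⟪α, d⟫ * ⟪α, d⟫ - 2 * (Z⁻¹ * M) * M + Z * (Z⁻¹ * M) ^ 2 := by
      rw [hZd, lseZ, Finset.sum_mul, ← lseZ, ← hZd]
      conv_rhs => rw [show 2 * (Z⁻¹ * M) * M = ∑ α ∈ A, 2 * (Z⁻¹ * M) * (Real.exp ⟪α, w⟫ * ⟪α, d⟫) by rw [← Finset.mul_sum]]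
      rw [← Finset.sum_sub_distrib, ← Finset.sum_add_distrib]
      refine Finset.sum_congr rfl fun α _ => by ring
    rw [this]; field_simp; ring
  rw [key]
  refine mul_pos (inv_pos.2 hZ) ?_
  obtain ⟨α, hα, hne⟩ := hd (Z⁻¹ * M)
  refine Finset.sum_pos' (fun _ _ => by positivity) ⟨α, hα, ?_⟩
  have := sub_ne_zero.2 hne
  positivity

lemma det_fderiv_lseG_pos (hA : A.Nonempty) (w : EuclideanSpace ℝ (Fin n))
    (hd : ∀ d : EuclideanSpace ℝ (Fin n), d ≠ 0 → ∀ c : ℝ, ∃ α ∈ A, ⟪α, d⟫ ≠ c) :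
    0 < (fderiv ℝ (lseG A) w).det := by
  set T : EuclideanSpace ℝ (Fin n) →ₗ[ℝ] EuclideanSpace ℝ (Fin n) := (fderiv ℝ (lseG A) w).toLinearMap with hT
  have hsym : T.IsSymmetric := by
    intro x y
    rw [real_inner_comm (T y) x]
    simp only [hT, ContinuousLinearMap.coe_coe]
    rw [inner_fderiv_lseG hA, inner_fderiv_lseG hA]
    congr 1
    · congr 1; exact Finset.sum_congr rfl fun _ _ => by ring
    · ring
  have hfin : Module.finrank ℝ (EuclideanSpace ℝ (Fin n)) = n := by simp
  change 0 < LinearMap.det T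
  rw [hsym.det_eq_prod_eigenvalues hfin]
  simp only [RCLike.ofReal_real_eq_id, id]
  refine Finset.prod_pos fun i _ => ?_
  have hn : ‖hsym.eigenvectorBasis hfin i‖ = 1 := (hsym.eigenvectorBasis hfin).norm_eq_one i
  have hb : hsym.eigenvectorBasis hfin i ≠ 0 := by
    intro h; rw [h] at hn; simp at hn
  have := inner_fderiv_lseG_pos hA w _ (hd _ hb)
  have h2 : fderiv ℝ (lseG A) w (hsym.eigenvectorBasis hfin i) = _ :=
    hsym.apply_eigenvectorBasis hfin i
  rw [h2, inner_smul_left, real_inner_self_eq_norm_sq, hn] at this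
  simpa using this

lemma lseG_injective (hA : A.Nonempty)
    (hd : ∀ d : EuclideanSpace ℝ (Fin n), d ≠ 0 → ∀ c : ℝ, ∃ α ∈ A, ⟪α, d⟫ ≠ c) :
    Function.Injective (lseG A) := by
  intro a b hab
  by_contra hne
  have hdne : b - a ≠ 0 := sub_ne_zero.2 (Ne.symm hne)
  let f : ℝ → ℝ := fun t => ⟪lseG A (a + t • (b - a)), b - a⟫
  have hf : ∀ t, HasDerivAt f ⟪fderiv ℝ (lseG A) (a + t • (b - a)) (b - a), b - a⟫ t := by
    intro t
    have h1 : HasDerivAt (fun t : ℝ => a + t • (b - a)) (b - a) t := by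
      simpa using ((hasDerivAt_id t).smul_const (b - a)).const_add a
    have h2 := (((contDiff_lseG hA).differentiable (by norm_num)) (a + t • (b - a))).hasFDerivAt.comp_hasDerivAt t h1
    have h3 := h2.inner ℝ (hasDerivAt_const t (b - a))
    simpa using h3
  have hmono : StrictMono f := strictMono_of_deriv_pos fun t => by
    rw [(hf t).deriv]; exact inner_fderiv_lseG_pos hA _ _ (hd _ hdne)
  have := hmono (show (0:ℝ) < 1 by norm_num)
  simp [f, hab] at this

lemma integrable_det_fderiv_lseG (hA : A.Nonempty)
    (hd : ∀ d : EuclideanSpace ℝ (Fin n), d ≠ 0 → ∀ c : ℝ, ∃ α ∈ A, ⟪α, d⟫ ≠ c) :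
    Integrable (fun w => (fderiv ℝ (lseG A) w).det) := by
  have hcont : Continuous (fun w => (fderiv ℝ (lseG A) w).det) :=
    ContinuousLinearMap.continuous_det.comp ((contDiff_lseG hA).continuous_fderiv (by norm_num))
  refine ⟨hcont.aestronglyMeasurable, ?_⟩
  rw [hasFiniteIntegral_iff_norm]
  have := lintegral_abs_det_fderiv_eq_addHaar_image (μ := (volume : Measure (EuclideanSpace ℝ (Fin n)))) (s := Set.univ) MeasurableSet.univ
    (f := lseG A) (f' := fderiv ℝ (lseG A))
    (fun x _ => (((contDiff_lseG hA).differentiable (by norm_num)) x).hasFDerivAt.hasFDerivWithinAt)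
    (lseG_injective hA hd).injOn
  rw [Measure.restrict_univ] at this
  simp only [Real.norm_eq_abs]
  rw [this]
  apply Bornology.IsBounded.measure_lt_top
  refine (Bornology.IsBounded.subset (isBounded_convexHull.2 A.finite_toSet.isBounded)) ?_
  rintro _ ⟨w, -, rfl⟩
  have : lseG A w = A.centerMass (fun α => Real.exp ⟪α, w⟫) id := by
    simp [Finset.centerMass, lseG, lseV, lseZ]
  rw [this]
  exact Finset.centerMass_mem_convexHull _ (fun _ _ => (Real.exp_pos _).le) (lseZ_pos hA w) (fun α h => h)

end LSE

section Env
variable {n : ℕ} {φ : EuclideanSpace ℝ (Fin n) → ℝ}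

lemma le_convEnv {g : EuclideanSpace ℝ (Fin n) → ℝ} (hg : ConvexOn ℝ Set.univ g)
    (hle : ∀ w, g w ≤ φ w) (v : EuclideanSpace ℝ (Fin n)) : g v ≤ convEnv φ v := by
  refine le_csSup ⟨φ v, ?_⟩ ⟨g, hg, hle, rfl⟩
  rintro _ ⟨h, -, hh, rfl⟩
  exact hh v

lemma convEnv_le_of {g₀ : EuclideanSpace ℝ (Fin n) → ℝ} (hg₀ : ConvexOn ℝ Set.univ g₀)
    (hle₀ : ∀ w, g₀ w ≤ φ w) (v : EuclideanSpace ℝ (Fin n)) (c : ℝ)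
    (h : ∀ g : EuclideanSpace ℝ (Fin n) → ℝ, ConvexOn ℝ Set.univ g → (∀ w, g w ≤ φ w) → g v ≤ c) :
    convEnv φ v ≤ c := by
  refine csSup_le ⟨_, g₀, hg₀, hle₀, rfl⟩ ?_
  rintro _ ⟨g, hg, hh, rfl⟩
  exact h g hg hh

lemma convexOn_convEnv {g₀ : EuclideanSpace ℝ (Fin n) → ℝ} (hg₀ : ConvexOn ℝ Set.univ g₀)
    (hle₀ : ∀ w, g₀ w ≤ φ w) : ConvexOn ℝ Set.univ (convEnv φ) := by
  refine ⟨convex_univ, fun x _ y _ a b ha hb hab => ?_⟩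
  refine convEnv_le_of hg₀ hle₀ _ _ fun g hg hle => ?_
  refine (hg.2 (Set.mem_univ x) (Set.mem_univ y) ha hb hab).trans ?_
  exact add_le_add (mul_le_mul_of_nonneg_left (le_convEnv hg hle x) ha)
    (mul_le_mul_of_nonneg_left (le_convEnv hg hle y) hb)

lemma convexOn_affine (p : EuclideanSpace ℝ (Fin n)) (c : ℝ) :
    ConvexOn ℝ Set.univ (fun w : EuclideanSpace ℝ (Fin n) => ⟪p, w⟫ + c) := by
  refine ⟨convex_univ, fun x _ y _ a b ha hb hab => ?_⟩
  simp only [inner_add_right, inner_smul_right, smul_eq_mul]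
  have : c = (a + b) * c := by rw [hab, one_mul]
  nlinarith

lemma exists_affine_convEnv {g₀ : EuclideanSpace ℝ (Fin n) → ℝ} (hg₀ : ConvexOn ℝ Set.univ g₀)
    (hle₀ : ∀ w, g₀ w ≤ φ w) (v : EuclideanSpace ℝ (Fin n)) (ε : ℝ) (hε : 0 < ε) :
    ∃ (p : EuclideanSpace ℝ (Fin n)) (c : ℝ), (∀ w, ⟪p, w⟫ + c ≤ φ w) ∧
      ⟪p, v⟫ + c = convEnv φ v - ε := by
  have hc := convexOn_convEnv hg₀ hle₀
  have hcont : Continuous (convEnv φ) := hc.locallyLipschitz.continuous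
  obtain ⟨l, c, h1, h2⟩ := hc.exists_affine_le_of_lt (𝕜 := ℝ) (x := v) (a := convEnv φ v - ε)
    (Set.mem_univ _) (by linarith) isClosed_univ (hcont.lowerSemicontinuous.lowerSemicontinuousOn _)
  have hl : ∀ w, ⟪(InnerProductSpace.toDual ℝ _).symm l, w⟫ = l w := fun w => by simp
  refine ⟨(InnerProductSpace.toDual ℝ _).symm l, c, fun w => ?_, ?_⟩
  · rw [hl]
    have := h1 ⟨w, Set.mem_univ w⟩
    have h3 : l w + c ≤ convEnv φ w := by simpa using this
    exact h3.trans (convEnv_le_of hg₀ hle₀ w _ fun g _ hh => hh w)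
  · rw [hl]; simpa using h2

lemma exists_lattice_near (x : EuclideanSpace ℝ (Fin n)) (k : ℕ) (hk : 1 ≤ k) :
    ∃ q : EuclideanSpace ℝ (Fin n), (∀ i, ∃ m : ℤ, q i = (m : ℝ) / (k : ℝ)) ∧
      ‖q - x‖ ≤ √n / k := by
  have hk0 : (0:ℝ) < k := by exact_mod_cast hk
  refine ⟨WithLp.toLp 2 fun i => (⌊(k:ℝ) * x i⌋ : ℝ) / k, fun i => ⟨⌊(k:ℝ) * x i⌋, rfl⟩, ?_⟩
  rw [EuclideanSpace.norm_eq]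
  have : ∀ i : Fin n, ‖(WithLp.toLp 2 (fun i => (⌊(k:ℝ) * x i⌋ : ℝ) / k) - x : EuclideanSpace ℝ (Fin n)) i‖ ^ 2 ≤ (1 / k : ℝ) ^ 2 := by
    intro i
    rw [Real.norm_eq_abs, sq_abs]
    have h1 := Int.floor_le ((k:ℝ) * x i)
    have h2 := (Int.lt_floor_add_one ((k:ℝ) * x i)).le
    have h3 : (WithLp.toLp 2 (fun i => (⌊(k:ℝ) * x i⌋ : ℝ) / k) - x : EuclideanSpace ℝ (Fin n)) i = ((⌊(k:ℝ) * x i⌋ : ℝ) - k * x i) / k := by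
      simp; field_simp
    rw [h3, div_pow, div_pow]
    exact div_le_div_of_nonneg_right (sq_le_sq' (by linarith) (by linarith)) (by positivity)
  calc _ ≤ √(∑ _i : Fin n, (1 / k : ℝ) ^ 2) := Real.sqrt_le_sqrt (Finset.sum_le_sum fun i _ => this i)
    _ = √n / k := by
      simp only [Finset.sum_const, Finset.card_univ, Fintype.card_fin, nsmul_eq_mul]
      rw [Real.sqrt_mul (by positivity), Real.sqrt_sq (by positivity)]; ring

lemma card_lattice_le (Δ : Set (EuclideanSpace ℝ (Fin n))) (B : ℕ) (hB : ∀ p ∈ Δ, ‖p‖ ≤ B)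
    (k : ℕ) (hk : 1 ≤ k) (L : Finset (EuclideanSpace ℝ (Fin n)))
    (hL : (L : Set (EuclideanSpace ℝ (Fin n))) = Δ ∩ {p | ∀ i, ∃ m : ℤ, p i = (m : ℝ) / (k : ℝ)}) :
    L.card ≤ (2 * B * k + 1) ^ n := by
  have hk0 : (0:ℝ) < k := by exact_mod_cast hk
  let T : Finset (Fin n → ℤ) := Fintype.piFinset fun _ => Finset.Icc (-((B * k : ℕ) : ℤ)) ((B * k : ℕ) : ℤ)
  have hT : T.card = (2 * B * k + 1) ^ n := by
    simp only [T, Fintype.card_piFinset, Int.card_Icc, Finset.prod_const, Finset.card_univ, Fintype.card_fin]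
    congr 1
    push_cast
    have : ((B:ℤ) * k + 1 - -(B * k)) = ((2 * B * k + 1 : ℕ) : ℤ) := by push_cast; ring
    rw [this, Int.toNat_natCast]
  rw [← hT]
  have hsub : L ⊆ T.image (fun m => (WithLp.toLp 2 fun i => (m i : ℝ) / k : EuclideanSpace ℝ (Fin n))) := by
    intro p hp
    have hp' : p ∈ (L : Set (EuclideanSpace ℝ (Fin n))) := hp
    rw [hL] at hp'
    obtain ⟨hpΔ, hpm⟩ := hp'
    choose m hm using hpm
    rw [Finset.mem_image]
    refine ⟨m, ?_, ?_⟩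
    · rw [Fintype.mem_piFinset]
      intro i
      have h1 : |p i| ≤ B := (PiLp.norm_apply_le p i).trans (hB p hpΔ)
      rw [hm i, abs_div, abs_of_pos hk0, div_le_iff₀ hk0] at h1
      rw [Finset.mem_Icc, ← abs_le]
      have h2 : ((|m i| : ℤ) : ℝ) ≤ (((B * k : ℕ) : ℤ) : ℝ) := by push_cast; exact h1
      exact_mod_cast h2
    · ext i; simp [hm i]
  exact (Finset.card_le_card hsub).trans Finset.card_image_le

end Env

section Core
variable {n : ℕ} {φ D : EuclideanSpace ℝ (Fin n) → ℝ}

lemma integrable_weight (hφ : Continuous φ) (hDi : Integrable D)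
    (p : EuclideanSpace ℝ (Fin n)) (c : ℝ) (hc : ∀ w, ⟪p, w⟫ - φ w ≤ c) (k : ℕ) :
    Integrable (fun w => Real.exp ((k : ℝ) * (⟪p, w⟫ - φ w)) * D w) := by
  refine hDi.bdd_mul (c := Real.exp (k * c)) ?_ (Eventually.of_forall fun w => ?_)
  · apply Continuous.aestronglyMeasurable; fun_prop
  · rw [Real.norm_eq_abs, abs_of_pos (Real.exp_pos _)]
    gcongr; exact hc w

lemma weight_le (hφ : Continuous φ) (hDi : Integrable D) (hD : ∀ w, 0 < D w)
    (p : EuclideanSpace ℝ (Fin n)) (c : ℝ) (hc : ∀ w, ⟪p, w⟫ - φ w ≤ c) (k : ℕ) :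
    ∫ w, Real.exp ((k : ℝ) * (⟪p, w⟫ - φ w)) * D w ≤ Real.exp (k * c) * ∫ w, D w := by
  rw [← integral_const_mul]
  refine integral_mono (integrable_weight hφ hDi p c hc k) (hDi.const_mul _) fun w => ?_
  have := (hD w).le
  dsimp only
  gcongr
  exact hc w

lemma weight_ge (hφ : Continuous φ) (hDi : Integrable D) (hD : ∀ w, 0 < D w)
    {Δ K : Set (EuclideanSpace ℝ (Fin n))} (hΔ : IsCompact Δ) (hK : IsCompact K)
    {C : ℝ} (hC : ∀ p ∈ Δ, ∀ w, ⟪p, w⟫ - φ w ≤ C)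
    (hcv : Continuous (convEnv φ)) {ε : ℝ} (hε : 0 < ε) :
    ∃ c > 0, ∀ x ∈ Δ ×ˢ K, ∀ k : ℕ, c * Real.exp (k * (⟪x.1, x.2⟫ - convEnv φ x.2 - ε)) ≤
      ∫ w, Real.exp ((k : ℝ) * (⟪x.1, w⟫ - φ w)) * D w := by
  refine (hΔ.prod hK).induction_on (p := fun s => ∃ c > 0, ∀ x ∈ s, ∀ k : ℕ,
    c * Real.exp (k * (⟪x.1, x.2⟫ - convEnv φ x.2 - ε)) ≤
      ∫ w, Real.exp ((k : ℝ) * (⟪x.1, w⟫ - φ w)) * D w) ⟨1, one_pos, by simp⟩ ?_ ?_ ?_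
  · rintro s t hst ⟨c, hc, h⟩
    exact ⟨c, hc, fun x hx => h x (hst hx)⟩
  · rintro s t ⟨c, hc, h⟩ ⟨c', hc', h'⟩
    refine ⟨min c c', lt_min hc hc', fun x hx k => ?_⟩
    rcases hx with hx | hx
    · exact (mul_le_mul_of_nonneg_right (min_le_left _ _) (Real.exp_pos _).le).trans (h x hx k)
    · exact (mul_le_mul_of_nonneg_right (min_le_right _ _) (Real.exp_pos _).le).trans (h' x hx k)
  · rintro ⟨p₀, v₀⟩ ⟨hp₀, hv₀⟩
    obtain ⟨w₀, hw₀⟩ : ∃ w, ⟪p₀, v₀⟫ - convEnv φ v₀ - ε < ⟪p₀, w⟫ - φ w := by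
      by_contra! hcon
      have := le_convEnv (convexOn_affine p₀ (-(⟪p₀, v₀⟫ - convEnv φ v₀ - ε))) (φ := φ)
        (fun w => by linarith [hcon w]) v₀
      linarith
    have hopen : IsOpen {y : (EuclideanSpace ℝ (Fin n) × EuclideanSpace ℝ (Fin n)) × EuclideanSpace ℝ (Fin n) |
        ⟪y.1.1, y.1.2⟫ - convEnv φ y.1.2 - ε < ⟪y.1.1, y.2⟫ - φ y.2} :=
      isOpen_lt (by fun_prop) (by fun_prop)
    obtain ⟨U, W, hU, hW, hUx, hWx, hsub⟩ := isOpen_prod_iff.1 hopen (p₀, v₀) w₀ hw₀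
    refine ⟨U ∩ Δ ×ˢ K, inter_mem (mem_nhdsWithin_of_mem_nhds (hU.mem_nhds hUx)) self_mem_nhdsWithin,
      ∫ w in W, D w, ?_, ?_⟩
    · rw [gt_iff_lt, setIntegral_pos_iff_support_of_nonneg_ae (Eventually.of_forall fun w => (hD w).le) hDi.integrableOn]
      have : Function.support D = Set.univ := by
        ext w; simp [(hD w).ne']
      rw [this, Set.univ_inter]
      exact hW.measure_pos _ ⟨w₀, hWx⟩
    · rintro ⟨p, v⟩ ⟨hxU, hpΔ, hvK⟩ k
      have hint := integrable_weight hφ hDi p C (hC p hpΔ) k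
      calc (∫ w in W, D w) * Real.exp (k * (⟪p, v⟫ - convEnv φ v - ε))
          = ∫ w in W, Real.exp (k * (⟪p, v⟫ - convEnv φ v - ε)) * D w := by
            rw [integral_const_mul, mul_comm]
        _ ≤ ∫ w in W, Real.exp ((k : ℝ) * (⟪p, w⟫ - φ w)) * D w := by
            refine setIntegral_mono_on (hDi.integrableOn.const_mul _) hint.integrableOn hW.measurableSet fun w hw => ?_
            have := (hD w).le
            have h2 : ⟪p, v⟫ - convEnv φ v - ε < ⟪p, w⟫ - φ w := hsub (Set.mk_mem_prod hxU hw)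
            gcongr
        _ ≤ _ := setIntegral_le_integral hint (Eventually.of_forall fun w => mul_nonneg (Real.exp_pos _).le (hD w).le)

theorem core_convergence
    {Δ : Set (EuclideanSpace ℝ (Fin n))} (hΔc : IsCompact Δ) (hΔconv : Convex ℝ Δ)
    (hΔint : (interior Δ).Nonempty)
    (hφ : Continuous φ) (hDi : Integrable D) (hD : ∀ w, 0 < D w)
    {C : ℝ} (hC : ∀ p ∈ Δ, ∀ w, ⟪p, w⟫ - φ w ≤ C)
    (hB : ∀ (p : EuclideanSpace ℝ (Fin n)) (c : ℝ), (∀ w, ⟪p, w⟫ + c ≤ φ w) → p ∈ Δ)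
    (Λ : ℕ → Finset (EuclideanSpace ℝ (Fin n)))
    (hΛ : ∀ k : ℕ, 1 ≤ k → ((Λ k : Set (EuclideanSpace ℝ (Fin n)))
      = Δ ∩ {p | ∀ i, ∃ m : ℤ, p i = (m : ℝ) / (k : ℝ)}))
    (N : ℕ → EuclideanSpace ℝ (Fin n) → ℝ)
    (hN : ∀ k p, N k p = ∫ w, Real.exp ((k : ℝ) * (⟪p, w⟫ - φ w)) * D w)
    (u : ℕ → EuclideanSpace ℝ (Fin n) → ℝ)
    (hu : ∀ k v, u k v
      = (k : ℝ)⁻¹ * Real.log (∑ p ∈ Λ k, Real.exp ((k : ℝ) * ⟪p, v⟫) / N k p))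
    (K : Set (EuclideanSpace ℝ (Fin n))) (hK : IsCompact K) :
    TendstoUniformlyOn u (convEnv φ) atTop K := by
  obtain ⟨p₀, hp₀⟩ := hΔint
  obtain ⟨r, hr, hball⟩ := Metric.mem_nhds_iff.1 (mem_interior_iff_mem_nhds.1 hp₀)
  have hp₀Δ : p₀ ∈ Δ := interior_subset hp₀
  have hg₀ := convexOn_affine p₀ (-C)
  have hle₀ : ∀ w, ⟪p₀, w⟫ + -C ≤ φ w := fun w => by linarith [hC p₀ hp₀Δ w]
  have hcv : Continuous (convEnv φ) := (convexOn_convEnv hg₀ hle₀).locallyLipschitz.continuous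
  have hM : 0 < ∫ w, D w := by
    rw [integral_pos_iff_support_of_nonneg (fun w => (hD w).le) hDi]
    have : Function.support D = Set.univ := by
      ext w; simp [(hD w).ne']
    rw [this]
    exact isOpen_univ.measure_pos _ ⟨0, trivial⟩
  set M := ∫ w, D w with hMdef
  obtain ⟨B₀, hB₀⟩ := hΔc.isBounded.exists_norm_le
  obtain ⟨B, hBB⟩ := exists_nat_ge B₀
  have hBn : ∀ p ∈ Δ, ‖p‖ ≤ B := fun p hp => (hB₀ p hp).trans hBB
  obtain ⟨R, hR⟩ := hK.isBounded.exists_norm_le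
  obtain ⟨F, hF⟩ := hK.exists_bound_of_continuousOn hcv.continuousOn
  rw [Metric.tendstoUniformlyOn_iff]
  intro ε hε
  obtain ⟨c, hc, hcN⟩ := weight_ge hφ hDi hD hΔc hK hC hcv (half_pos hε)
  set C2 : ℝ := |F| + B * |R| + |C| with hC2
  have hC2n : 0 ≤ C2 := by positivity
  obtain ⟨t, ht0, ht1, htC⟩ : ∃ t : ℝ, 0 < t ∧ t ≤ 1 ∧ t * C2 ≤ ε / 4 := by
    refine ⟨min 1 (ε / (4 * (C2 + 1))), by positivity, min_le_left _ _, ?_⟩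
    calc min 1 (ε / (4 * (C2 + 1))) * C2 ≤ ε / (4 * (C2 + 1)) * (C2 + 1) := by
          gcongr
          · exact min_le_right _ _
          · linarith
      _ = ε / 4 := by field_simp
  have hcast : Tendsto (fun k : ℕ => (k : ℝ)) atTop atTop := tendsto_natCast_atTop_atTop
  have e1 : ∀ᶠ k : ℕ in atTop, √n / k < t * r :=
    (tendsto_const_nhds.div_atTop hcast).eventually_lt_const (by positivity)
  have e2 : ∀ᶠ k : ℕ in atTop, Real.log M / k < ε / 4 :=
    (tendsto_const_nhds.div_atTop hcast).eventually_lt_const (by positivity)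
  have e3 : ∀ᶠ k : ℕ in atTop,
      (n * Real.log (2 * B + 1) - Real.log c) / k + n * (Real.log k / k) < ε / 2 := by
    have h1 : Tendsto (fun k : ℕ => Real.log k / (k:ℝ)) atTop (nhds 0) := by
      have := (Real.tendsto_pow_log_div_mul_add_atTop 1 0 1 one_ne_zero).comp hcast
      simpa [Function.comp_def] using this
    have h2 : Tendsto (fun k : ℕ => (n * Real.log (2 * B + 1) - Real.log c) / k +
        n * (Real.log k / k)) atTop (nhds (0 + n * 0)) :=
      (tendsto_const_nhds.div_atTop hcast).add (h1.const_mul _)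
    exact h2.eventually_lt_const (by simp; positivity)
  filter_upwards [e1, e2, e3, eventually_ge_atTop 1] with k h1 h2 h3 hk v hv
  have hk0 : (0:ℝ) < k := by exact_mod_cast hk
  have hmemΛ : ∀ q, q ∈ Λ k ↔ q ∈ Δ ∧ ∀ i, ∃ m : ℤ, q i = (m : ℝ) / (k : ℝ) := by
    intro q
    rw [← Finset.mem_coe, hΛ k hk]; rfl
  have hNpos : ∀ p ∈ Λ k, 0 < N k p := by
    intro p hp
    rw [hN]
    exact lt_of_lt_of_le (by positivity) (hcN (p, v) ⟨((hmemΛ p).1 hp).1, hv⟩ k)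
  have hFv : |convEnv φ v| ≤ |F| := (hF v hv).trans (le_abs_self F)
  -- lower bound
  have hsum : Real.exp (k * (convEnv φ v - ε / 2)) / M ≤
      ∑ p ∈ Λ k, Real.exp ((k : ℝ) * ⟪p, v⟫) / N k p := by
    obtain ⟨p, c', hpc, hpv⟩ := exists_affine_convEnv hg₀ hle₀ v (ε / 4) (by positivity)
    have hpΔ : p ∈ Δ := hB p c' hpc
    obtain ⟨q, hqm, hq⟩ := exists_lattice_near ((1 - t) • p + t • p₀) k hk
    set p' := p₀ + t⁻¹ • (q - ((1 - t) • p + t • p₀)) with hp'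
    have hp'Δ : p' ∈ Δ := by
      apply hball
      rw [Metric.mem_ball, dist_eq_norm, hp', add_sub_cancel_left, norm_smul, norm_inv,
        Real.norm_eq_abs, abs_of_pos ht0, inv_mul_lt_iff₀ ht0]
      exact lt_of_le_of_lt hq h1
    have hqe : q = (1 - t) • p + t • p' := by
      rw [hp', smul_add, smul_smul, mul_inv_cancel₀ ht0.ne', one_smul]; abel
    have hqΔ : q ∈ Δ := by
      rw [hqe]; exact hΔconv hpΔ hp'Δ (by linarith) ht0.le (by ring)
    have hqΛ : q ∈ Λ k := (hmemΛ q).2 ⟨hqΔ, hqm⟩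
    have hqin : ∀ w, ⟪q, w⟫ = (1 - t) * ⟪p, w⟫ + t * ⟪p', w⟫ := fun w => by
      rw [hqe, inner_add_left, real_inner_smul_left, real_inner_smul_left]
    have hqb : ∀ w, ⟪q, w⟫ - φ w ≤ (1 - t) * (-c') + t * C := by
      intro w
      have a1 := mul_le_mul_of_nonneg_left (hpc w) (show 0 ≤ 1 - t by linarith)
      have a2 := mul_le_mul_of_nonneg_left (hC p' hp'Δ w) ht0.le
      rw [hqin]; nlinarith
    have hNq := weight_le hφ hDi hD q _ hqb k
    rw [← hN, ← hMdef] at hNq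
    have hin : |⟪p', v⟫| ≤ B * |R| := (abs_real_inner_le_norm _ _).trans
      (mul_le_mul (hBn _ hp'Δ) ((hR v hv).trans (le_abs_self R)) (norm_nonneg _) (by positivity))
    have hfin : convEnv φ v - ε / 2 ≤ ⟪q, v⟫ - ((1 - t) * (-c') + t * C) := by
      have b1 : ⟪q, v⟫ - ((1 - t) * (-c') + t * C)
          = convEnv φ v - (1 - t) * (ε / 4) - t * (convEnv φ v - ⟪p', v⟫ + C) := by
        rw [hqin]; linear_combination (1 - t) * hpv
      have b2 : convEnv φ v - ⟪p', v⟫ + C ≤ C2 := by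
        linarith [le_abs_self (convEnv φ v), neg_abs_le ⟪p', v⟫, le_abs_self C]
      have b3 := mul_le_mul_of_nonneg_left b2 ht0.le
      have b4 : 0 ≤ t * (ε / 4) := by positivity
      rw [b1]; linarith
    calc Real.exp (k * (convEnv φ v - ε / 2)) / M
        ≤ Real.exp (k * (⟪q, v⟫ - ((1 - t) * (-c') + t * C))) / M := by gcongr
      _ = Real.exp (k * ⟪q, v⟫) / (Real.exp (k * ((1 - t) * (-c') + t * C)) * M) := by
        rw [mul_sub, Real.exp_sub, div_div]
      _ ≤ Real.exp (k * ⟪q, v⟫) / N k q := by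
        have := hNpos q hqΛ
        gcongr
      _ ≤ _ := Finset.single_le_sum (f := fun p => Real.exp ((k : ℝ) * ⟪p, v⟫) / N k p)
        (fun p hp => div_nonneg (Real.exp_pos _).le (hNpos p hp).le) hqΛ
  have hlow : convEnv φ v - ε / 2 - Real.log M / k ≤ u k v := by
    have := Real.log_le_log (by positivity) hsum
    rw [Real.log_div (Real.exp_pos _).ne' hM.ne', Real.log_exp] at this
    rw [hu]
    calc _ = (k:ℝ)⁻¹ * (k * (convEnv φ v - ε / 2) - Real.log M) := by field_simp
      _ ≤ _ := by gcongr
  have hup : u k v ≤ convEnv φ v + ε / 2 +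
      ((n * Real.log (2 * B + 1) - Real.log c) / k + n * (Real.log k / k)) := by
    have hpos : 0 < ∑ p ∈ Λ k, Real.exp ((k : ℝ) * ⟪p, v⟫) / N k p :=
      lt_of_lt_of_le (by positivity) hsum
    have hs2 : ∑ p ∈ Λ k, Real.exp ((k : ℝ) * ⟪p, v⟫) / N k p ≤
        (((2 * B + 1) * k) ^ n : ℝ) * (Real.exp (k * (convEnv φ v + ε / 2)) / c) := by
      calc _ ≤ (Λ k).card • (Real.exp (k * (convEnv φ v + ε / 2)) / c) := by
            refine Finset.sum_le_card_nsmul _ _ _ fun p hp => ?_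
            have hx := hcN (p, v) ⟨((hmemΛ p).1 hp).1, hv⟩ k
            rw [← hN] at hx
            rw [div_le_div_iff₀ (hNpos p hp) hc]
            calc Real.exp (k * ⟪p, v⟫) * c
                = Real.exp (k * (convEnv φ v + ε / 2)) *
                  (c * Real.exp (k * (⟪p, v⟫ - convEnv φ v - ε / 2))) := by
                  rw [mul_left_comm, ← Real.exp_add, mul_comm]
                  congr 2; ring
              _ ≤ _ := by gcongr
        _ ≤ _ := by
            rw [nsmul_eq_mul]
            gcongr
            have hcard := card_lattice_le Δ B hBn k hk (Λ k) (hΛ k hk)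
            have : (2 * B * k + 1) ^ n ≤ ((2 * B + 1) * k) ^ n := by
              apply Nat.pow_le_pow_left; nlinarith
            exact_mod_cast hcard.trans this
    have := Real.log_le_log hpos hs2
    rw [Real.log_mul (by positivity) (by positivity), Real.log_pow,
      Real.log_mul (by positivity) (by positivity), Real.log_div (Real.exp_pos _).ne' hc.ne',
      Real.log_exp] at this
    rw [hu]
    calc _ ≤ (k:ℝ)⁻¹ * _ := mul_le_mul_of_nonneg_left this (by positivity)
      _ = _ := by field_simp; ring
  rw [Real.dist_eq, abs_lt]
  constructor <;> linarith

end Core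

/-- toric model of the uniform convergence of the Bergman metrics
`k^{−1} log K_k(x,x) → φ_e` on compact subsets of `X − B₊(L)`. With `φ = φ_Δ + χ` as in
the toric setup, the functions `u_k(v) = k^{−1} log( ∑_{p ∈ Λ_k} e^{k⟨p,v⟩}/N_{k,p} )`
converge to the convex envelope `φ_e` uniformly on every compact subset of `ℝⁿ`. -/
theorem bergman_metric_uniform_convergence_toric (n : ℕ) (hn : 1 ≤ n)
    (S : Finset (EuclideanSpace ℝ (Fin n)))
    (hS : ∀ α ∈ S, ∀ i, ∃ m : ℤ, α i = (m : ℝ))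
    (Δ : Set (EuclideanSpace ℝ (Fin n)))
    (hΔ : Δ = convexHull ℝ (S : Set (EuclideanSpace ℝ (Fin n))))
    (hΔint : (interior Δ).Nonempty)
    (A : Finset (EuclideanSpace ℝ (Fin n)))
    (hA : (A : Set (EuclideanSpace ℝ (Fin n))) = Δ ∩ {v | ∀ i, ∃ m : ℤ, v i = (m : ℝ)})
    (φΔ χ φ : EuclideanSpace ℝ (Fin n) → ℝ)
    (hφΔ : ∀ v, φΔ v = Real.log (∑ α ∈ A, Real.exp ⟪α, v⟫))
    (hχ : ContDiff ℝ (⊤ : ℕ∞) χ) (hχc : HasCompactSupport χ)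
    (hφ : φ = φΔ + χ)
    (Λ : ℕ → Finset (EuclideanSpace ℝ (Fin n)))
    (hΛ : ∀ k : ℕ, 1 ≤ k → ((Λ k : Set (EuclideanSpace ℝ (Fin n)))
      = Δ ∩ {p | ∀ i, ∃ m : ℤ, p i = (m : ℝ) / (k : ℝ)}))
    (N : ℕ → EuclideanSpace ℝ (Fin n) → ℝ)
    (hN : ∀ k p, N k p
      = ∫ w, Real.exp ((k : ℝ) * (⟪p, w⟫ - φ w)) * (fderiv ℝ (gradient φΔ) w).det)
    (u : ℕ → EuclideanSpace ℝ (Fin n) → ℝ)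
    (hu : ∀ k v, u k v
      = (k : ℝ)⁻¹ * Real.log (∑ p ∈ Λ k, Real.exp ((k : ℝ) * ⟪p, v⟫) / N k p)) :
    ∀ K : Set (EuclideanSpace ℝ (Fin n)), IsCompact K →
      TendstoUniformlyOn u (convEnv φ) atTop K := by
  have hΔc : IsCompact Δ := hΔ ▸ S.finite_toSet.isCompact_convexHull ℝ
  have hΔconv : Convex ℝ Δ := hΔ ▸ convex_convexHull ℝ _
  have hSΔ : ∀ α ∈ S, α ∈ Δ := fun α hα => hΔ ▸ subset_convexHull ℝ _ hα
  have hmemA : ∀ α, α ∈ A ↔ α ∈ Δ ∧ ∀ i, ∃ m : ℤ, α i = (m : ℝ) := by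
    intro α
    rw [← Finset.mem_coe, hA]; rfl
  have hSA : ∀ α ∈ S, α ∈ A := fun α hα => (hmemA α).2 ⟨hSΔ α hα, hS α hα⟩
  have hAne : A.Nonempty := by
    have h1 : Δ.Nonempty := hΔint.mono interior_subset
    rw [hΔ, convexHull_nonempty_iff] at h1
    obtain ⟨α, hα⟩ := h1
    exact ⟨α, hSA α hα⟩
  have hd : ∀ d : EuclideanSpace ℝ (Fin n), d ≠ 0 → ∀ c : ℝ, ∃ α ∈ A, ⟪α, d⟫ ≠ c := by
    intro d hd0 c
    by_contra! hcon
    have hsub : Δ ⊆ {x | ⟪x, d⟫ = c} := by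
      rw [hΔ]
      refine convexHull_min (fun α hα => hcon α (hSA α hα)) ?_
      intro x hx y hy a b _ _ hab
      simp only [Set.mem_ofPred_eq] at hx hy ⊢
      rw [inner_add_left, real_inner_smul_left, real_inner_smul_left, hx, hy, ← add_mul, hab,
        one_mul]
    obtain ⟨p₀, hp₀⟩ := hΔint
    have hmem : Δ ∈ nhds p₀ := mem_interior_iff_mem_nhds.1 hp₀
    have hlim : Tendsto (fun s : ℝ => p₀ + s • d) (nhds 0) (nhds p₀) := by
      have : Continuous (fun s : ℝ => p₀ + s • d) := by fun_prop
      simpa using this.tendsto 0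
    obtain ⟨s, hs, hs0⟩ : ∃ s : ℝ, p₀ + s • d ∈ Δ ∧ 0 < s :=
      (((hlim.mono_left nhdsWithin_le_nhds).eventually hmem).and
        (self_mem_nhdsWithin : ∀ᶠ s : ℝ in nhdsWithin 0 (Set.Ioi 0), 0 < s)).exists
    have h1 : ⟪p₀ + s • d, d⟫ = c := hsub hs
    have h2 : ⟪p₀, d⟫ = c := hsub (interior_subset hp₀)
    rw [inner_add_left, real_inner_smul_left, h2, real_inner_self_eq_norm_sq] at h1
    have : 0 < s * ‖d‖ ^ 2 := by positivity
    linarith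
  have hφΔ' : φΔ = fun w => Real.log (∑ α ∈ A, Real.exp ⟪α, w⟫) := funext hφΔ
  have hZ : ∀ w, 0 < ∑ α ∈ A, Real.exp ⟪α, w⟫ := fun w => lseZ_pos hAne w
  have hgrad : gradient φΔ = lseG A := by rw [hφΔ']; exact gradient_lse hAne
  have hφc : Continuous φ := by
    rw [hφ, hφΔ']
    refine Continuous.add (Continuous.log ?_ fun w => (hZ w).ne') hχ.continuous
    fun_prop
  obtain ⟨Cχ, hCχ⟩ := hχc.exists_bound_of_continuous hχ.continuous
  have hC : ∀ p ∈ Δ, ∀ w, ⟪p, w⟫ - φ w ≤ Cχ := by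
    intro p hp w
    have hsub : Δ ⊆ {x | ⟪x, w⟫ ≤ φΔ w} := by
      rw [hΔ]
      refine convexHull_min (fun α hα => ?_) ?_
      · change ⟪α, w⟫ ≤ φΔ w
        rw [hφΔ, Real.le_log_iff_exp_le (hZ w)]
        exact Finset.single_le_sum (f := fun α => Real.exp ⟪α, w⟫)
          (fun _ _ => (Real.exp_pos _).le) (hSA α hα)
      · intro x hx y hy a b ha hb hab
        simp only [Set.mem_ofPred_eq] at hx hy ⊢
        rw [inner_add_left, real_inner_smul_left, real_inner_smul_left]
        calc _ ≤ a * φΔ w + b * φΔ w := by gcongr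
          _ = φΔ w := by rw [← add_mul, hab, one_mul]
    have h1 : ⟪p, w⟫ ≤ φΔ w := hsub hp
    have h2 := (abs_le.1 (hCχ w)).1
    rw [hφ, Pi.add_apply]
    linarith
  have hB : ∀ (p : EuclideanSpace ℝ (Fin n)) (c : ℝ), (∀ w, ⟪p, w⟫ + c ≤ φ w) → p ∈ Δ := by
    intro p c hpc
    by_contra hp
    obtain ⟨f, s, hf, hs⟩ := geometric_hahn_banach_closed_point hΔconv hΔc.isClosed hp
    have hl : ∀ x, ⟪x, (InnerProductSpace.toDual ℝ _).symm f⟫ = f x := fun x => by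
      rw [real_inner_comm]; simp
    set d := (InnerProductSpace.toDual ℝ _).symm f with hddef
    have hub : ∀ t : ℝ, 0 ≤ t → t * f p + c ≤ Real.log A.card + t * s + Cχ := by
      intro t ht
      have h1 := hpc (t • d)
      rw [inner_smul_right, hl, hφ, Pi.add_apply, hφΔ] at h1
      have h2 := (abs_le.1 (hCχ (t • d))).2
      have h3 : Real.log (∑ α ∈ A, Real.exp ⟪α, t • d⟫) ≤ Real.log A.card + t * s := by
        have hc0 : (0:ℝ) < A.card := by exact_mod_cast hAne.card_pos
        rw [Real.log_le_iff_le_exp (hZ _), Real.exp_add, Real.exp_log hc0, ← nsmul_eq_mul]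
        refine Finset.sum_le_card_nsmul _ _ _ fun α hα => ?_
        rw [inner_smul_right, hl]
        gcongr
        exact (hf α ((hmemA α).1 hα).1).le
      linarith
    have hgap : 0 < f p - s := by linarith
    set X := Real.log A.card + Cχ - c with hX
    have h1 := hub ((|X| + 1) / (f p - s)) (by positivity)
    have h2 : (|X| + 1) / (f p - s) * (f p - s) = |X| + 1 := by field_simp
    have h3 := le_abs_self X
    nlinarith
  have hN' : ∀ k p, N k p = ∫ w, Real.exp ((k : ℝ) * (⟪p, w⟫ - φ w)) *
      (fderiv ℝ (lseG A) w).det := by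
    intro k p
    rw [hN, hgrad]
  intro K hK
  exact core_convergence hΔc hΔconv hΔint hφc (integrable_det_fderiv_lseG hAne hd)
    (fun w => det_fderiv_lseG_pos hAne w hd) hC hB Λ hΛ N hN' u hu K hK
end

section
/- Let Δ ⊂ ℝ^n (n ≥ 1) be the convex hull of a finite subset of ℤ^n with nonempty interior, φ_Δ(v) = log(Σ_{α ∈ Δ∩ℤ^n} e^{⟨α,v⟩}), χ : ℝ^n → ℝ smooth with compact support, φ = φ_Δ + χ, φ_e the convex envelope of φ, and B_k the toric Bergman function. Then: (a) there is a constant C > 0 such that for every integer k ≥ 1 and every v ∈ ℝ^n, B_k(v) ≤ C k^n e^{−k(φ(v) − φ_e(v))}; and (b) for every compact set Ω ⊂ ℝ^n there is a constant C_Ω > 0 such that for every k ≥ 1 and every v ∈ Ω, B_k(v) ≥ C_Ω^{−1} e^{−k(φ(v) − φ_e(v))}. (This is the toric-model instance of the two-sided estimate e^{−k(φ−φ_e)} C_Ω^{−1} ≤ B_k ≤ C_Ω k^n e^{−k(φ−φ_e)}.) -/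
open scoped RealInnerProductSpace
open MeasureTheory Filter

section
abbrev EE (n : ℕ) := EuclideanSpace ℝ (Fin n)

noncomputable def Zf {n : ℕ} (A : Finset (EE n)) (v : EE n) : ℝ := ∑ α ∈ A, Real.exp ⟪α, v⟫

noncomputable def lse {n : ℕ} (A : Finset (EE n)) (v : EE n) : ℝ := Real.log (Zf A v)

noncomputable def qf {n : ℕ} (A : Finset (EE n)) (v : EE n) (α : EE n) : ℝ :=
  Real.exp ⟪α, v⟫ / Zf A v

noncomputable def Gf {n : ℕ} (A : Finset (EE n)) (v : EE n) : EE n := ∑ α ∈ A, qf A v α • α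

noncomputable def Hf {n : ℕ} (A : Finset (EE n)) (v : EE n) : EE n →L[ℝ] EE n :=
  ∑ α ∈ A, (qf A v α • (innerSL ℝ (α - Gf A v))).smulRight α

section calc1
variable {n : ℕ} {A : Finset (EE n)}

lemma Zf_pos (hA : A.Nonempty) (v : EE n) : 0 < Zf A v :=
  Finset.sum_pos (fun _ _ => Real.exp_pos _) hA

lemma qf_pos (hA : A.Nonempty) (v α : EE n) : 0 < qf A v α :=
  div_pos (Real.exp_pos _) (Zf_pos hA v)

lemma sum_qf (hA : A.Nonempty) (v : EE n) : ∑ α ∈ A, qf A v α = 1 := by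
  unfold qf
  rw [← Finset.sum_div]
  exact div_self (Zf_pos hA v).ne'

lemma qf_le_one (hA : A.Nonempty) (v : EE n) {α : EE n} (h : α ∈ A) : qf A v α ≤ 1 := by
  rw [← sum_qf hA v]
  exact Finset.single_le_sum (f := qf A v) (fun a _ => (qf_pos hA v a).le) h

lemma hasFDerivAt_exp_inner (α v : EE n) :
    HasFDerivAt (fun w => Real.exp ⟪α, w⟫) (Real.exp ⟪α, v⟫ • innerSL ℝ α) v := by
  have h : HasFDerivAt (fun w => ⟪α, w⟫) (innerSL ℝ α) v := (innerSL ℝ α).hasFDerivAt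
  exact h.exp

lemma hasFDerivAt_Zf (v : EE n) :
    HasFDerivAt (Zf A) (∑ α ∈ A, Real.exp ⟪α, v⟫ • innerSL ℝ α) v := by
  exact HasFDerivAt.fun_sum (fun α _ => hasFDerivAt_exp_inner α v)

lemma hasFDerivAt_lse (hA : A.Nonempty) (v : EE n) :
    HasFDerivAt (lse A) (innerSL ℝ (Gf A v)) v := by
  have h := (hasFDerivAt_Zf (A := A) v).log (Zf_pos hA v).ne'
  have e : innerSL ℝ (Gf A v) = (Zf A v)⁻¹ • ∑ α ∈ A, Real.exp ⟪α, v⟫ • innerSL ℝ α := by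
    simp only [Gf, qf, map_sum, map_smul, Finset.smul_sum, smul_smul]
    exact Finset.sum_congr rfl fun _ _ => by rw [div_eq_inv_mul]
  rw [e]
  exact h

lemma gradient_lse_s12 (hA : A.Nonempty) : gradient (lse A) = Gf A := by
  funext v
  have : HasGradientAt (lse A) (Gf A v) v := by
    rw [hasGradientAt_iff_hasFDerivAt]
    exact hasFDerivAt_lse hA v
  exact this.gradient

lemma hasFDerivAt_qf (hA : A.Nonempty) (v α : EE n) :
    HasFDerivAt (fun w => qf A w α) (qf A v α • innerSL ℝ (α - Gf A v)) v := by
  have e : (fun w => qf A w α) = fun w => Real.exp (⟪α, w⟫ - lse A w) := by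
    funext w
    rw [Real.exp_sub, lse, Real.exp_log (Zf_pos hA w), qf]
  have h : HasFDerivAt (fun w => ⟪α, w⟫) (innerSL ℝ α) v := (innerSL ℝ α).hasFDerivAt
  have h2 := (h.sub (hasFDerivAt_lse hA v)).exp
  have e2 := congrFun e v
  rw [e, e2, map_sub]
  exact h2

lemma hasFDerivAt_Gf (hA : A.Nonempty) (v : EE n) :
    HasFDerivAt (Gf A) (Hf A v) v := by
  exact HasFDerivAt.fun_sum (fun α _ => (hasFDerivAt_qf hA v α).smul_const α)

lemma fderiv_gradient_lse (hA : A.Nonempty) (v : EE n) :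
    fderiv ℝ (gradient (lse A)) v = Hf A v := by
  rw [gradient_lse_s12 hA]; exact (hasFDerivAt_Gf hA v).fderiv

lemma inner_Hf (v h g : EE n) :
    ⟪Hf A v h, g⟫ = ∑ α ∈ A, qf A v α * ⟪α - Gf A v, h⟫ * ⟪α, g⟫ := by
  simp [Hf, sum_inner, inner_smul_left, inner_sub_left]

lemma inner_Gf (v g : EE n) : ⟪Gf A v, g⟫ = ∑ α ∈ A, qf A v α * ⟪α, g⟫ := by
  simp [Gf, sum_inner, inner_smul_left]

lemma inner_Hf' (hA : A.Nonempty) (v h g β : EE n) :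
    ⟪Hf A v h, g⟫ = ∑ α ∈ A, qf A v α * ⟪α - β, h⟫ * ⟪α - β, g⟫ -
      (∑ α ∈ A, qf A v α * ⟪α - β, h⟫) * (∑ α ∈ A, qf A v α * ⟪α - β, g⟫) := by
  have h1 : ∀ x : EE n, ∑ α ∈ A, qf A v α * ⟪α - β, x⟫ = ⟪Gf A v, x⟫ - ⟪β, x⟫ := by
    intro x
    rw [inner_Gf]
    simp only [inner_sub_left, mul_sub, Finset.sum_sub_distrib, ← Finset.sum_mul, sum_qf hA v,
      one_mul]
  rw [inner_Hf, h1, h1]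
  have h2 : ∑ α ∈ A, qf A v α * ⟪α - β, h⟫ * ⟪α - β, g⟫ =
      ∑ α ∈ A, qf A v α * ⟪α - Gf A v, h⟫ * ⟪α, g⟫
      + ⟪Gf A v - β, h⟫ * ∑ α ∈ A, qf A v α * ⟪α, g⟫
      - ⟪β, g⟫ * ∑ α ∈ A, qf A v α * ⟪α - β, h⟫ := by
    rw [Finset.mul_sum, Finset.mul_sum, ← Finset.sum_add_distrib, ← Finset.sum_sub_distrib]
    refine Finset.sum_congr rfl fun α _ => ?_
    simp only [inner_sub_left]; ring
  rw [h2, h1, ← inner_Gf, inner_sub_left]; ring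

lemma Hf_symm (hA : A.Nonempty) (v : EE n) : ((Hf A v : EE n →L[ℝ] EE n) : EE n →ₗ[ℝ] EE n).IsSymmetric := by
  intro h g
  have e1 := inner_Hf' hA v h g 0
  have e2 := inner_Hf' hA v g h 0
  simp only [ContinuousLinearMap.coe_coe]
  rw [real_inner_comm (Hf A v g) h, e1, e2]
  congr 1
  · exact Finset.sum_congr rfl fun _ _ => by ring
  · ring

lemma contDiff_Zf : ContDiff ℝ 2 (Zf A) := by
  unfold Zf
  exact ContDiff.sum fun α _ => (contDiff_const.inner ℝ contDiff_id).exp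

lemma continuous_Zf : Continuous (Zf A) := contDiff_Zf.continuous

lemma continuous_lse (hA : A.Nonempty) : Continuous (lse A) :=
  continuous_Zf.log fun v => (Zf_pos hA v).ne'

lemma continuous_qf (hA : A.Nonempty) (α : EE n) : Continuous (fun v => qf A v α) := by
  unfold qf
  exact ((continuous_const.inner continuous_id).rexp).div continuous_Zf fun v => (Zf_pos hA v).ne'

lemma continuous_Gf (hA : A.Nonempty) : Continuous (Gf A) := by
  unfold Gf
  exact continuous_finsetSum _ fun α _ => (continuous_qf hA α).smul continuous_const

lemma continuous_Hf (hA : A.Nonempty) : Continuous (Hf A) := by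
  unfold Hf
  refine continuous_finsetSum _ fun α _ => ?_
  have h : Continuous fun v => qf A v α • innerSL ℝ (α - Gf A v) :=
    (continuous_qf hA α).smul ((innerSL ℝ (E := EE n)).continuous.comp
      (continuous_const.sub (continuous_Gf hA)))
  exact (ContinuousLinearMap.smulRightL ℝ (EE n) (EE n)).flip α |>.continuous.comp h

lemma continuous_det_Hf (hA : A.Nonempty) : Continuous (fun v => (Hf A v).det) :=
  ContinuousLinearMap.continuous_det.comp (continuous_Hf hA)

/-- variance lower bound -/
lemma inner_Hf_ge (hA : A.Nonempty) (v h : EE n) {β : EE n} (hβ : β ∈ A) :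
    qf A v β * ∑ α ∈ A, qf A v α * ⟪α - β, h⟫ ^ 2 ≤ ⟪Hf A v h, h⟫ := by
  rw [inner_Hf' hA v h h β]
  have h1 : ∑ α ∈ A, qf A v α * ⟪α - β, h⟫ * ⟪α - β, h⟫ = ∑ α ∈ A, qf A v α * ⟪α - β, h⟫ ^ 2 :=
    Finset.sum_congr rfl fun _ _ => by ring
  rw [h1]
  classical
  have e1 : ∑ α ∈ A, qf A v α * ⟪α - β, h⟫ = ∑ α ∈ A.erase β, qf A v α * ⟪α - β, h⟫ := by
    rw [← Finset.add_sum_erase A _ hβ]; simp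
  have e2 : ∑ α ∈ A, qf A v α * ⟪α - β, h⟫ ^ 2 = ∑ α ∈ A.erase β, qf A v α * ⟪α - β, h⟫ ^ 2 := by
    rw [← Finset.add_sum_erase A _ hβ]; simp
  have e3 : ∑ α ∈ A.erase β, qf A v α = 1 - qf A v β := by
    rw [← sum_qf hA v, ← Finset.add_sum_erase A _ hβ]; ring
  have cs : (∑ α ∈ A.erase β, qf A v α * ⟪α - β, h⟫) ^ 2 ≤
      (∑ α ∈ A.erase β, qf A v α) * ∑ α ∈ A.erase β, qf A v α * ⟪α - β, h⟫ ^ 2 := by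
    apply Finset.sum_sq_le_sum_mul_sum_of_sq_le_mul
    · exact fun i _ => (qf_pos hA v i).le
    · exact fun i _ => mul_nonneg (qf_pos hA v i).le (sq_nonneg _)
    · intro i _; apply le_of_eq; ring
  rw [e1, e2]
  rw [e3] at cs
  nlinarith [cs]

end calc1

end

section
section det
variable {n : ℕ}

lemma det_ge_pow (K : EE n →ₗ[ℝ] EE n) (hK : K.IsSymmetric) (c : ℝ) (hc : 0 ≤ c)
    (h : ∀ x, c * ‖x‖ ^ 2 ≤ ⟪K x, x⟫) : c ^ n ≤ LinearMap.det K := by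
  have hn : Module.finrank ℝ (EE n) = n := by simp
  rw [hK.det_eq_prod_eigenvalues hn]
  have : ∀ i, c ≤ hK.eigenvalues hn i := by
    intro i
    have h1 := h (hK.eigenvectorBasis hn i)
    rw [hK.apply_eigenvectorBasis hn i, inner_smul_left] at h1
    simpa using h1
  calc c ^ n = ∏ _i : Fin n, c := by simp
    _ ≤ ∏ i, hK.eigenvalues hn i := Finset.prod_le_prod (fun _ _ => hc) (fun i _ => this i)
    _ = _ := by simp

lemma det_adj (T : EE n →ₗ[ℝ] EE n) : LinearMap.det T.adjoint = LinearMap.det T := by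
  let b := EuclideanSpace.basisFun (Fin n) ℝ
  rw [← LinearMap.det_toMatrix b.toBasis, ← LinearMap.det_toMatrix b.toBasis,
    LinearMap.toMatrix_adjoint, Matrix.det_conjTranspose]
  simp

lemma det_ge_of_form (H T : EE n →ₗ[ℝ] EE n) (hH : H.IsSymmetric) (hT : LinearMap.det T ≠ 0)
    (c : ℝ) (hc : 0 ≤ c) (h : ∀ x, c * ‖T x‖ ^ 2 ≤ ⟪H x, x⟫) :
    c ^ n * (LinearMap.det T) ^ 2 ≤ LinearMap.det H := by
  let e := LinearEquiv.ofIsUnitDet (f := T) (v := (EuclideanSpace.basisFun (Fin n) ℝ).toBasis)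
    (v' := (EuclideanSpace.basisFun (Fin n) ℝ).toBasis)
    (by rw [LinearMap.det_toMatrix]; exact isUnit_iff_ne_zero.2 hT)
  have he : ∀ x, e x = T x := fun x => rfl
  let R : EE n →ₗ[ℝ] EE n := e.symm
  have hTR : ∀ x, T (R x) = x := fun x => by rw [← he]; exact e.apply_symm_apply x
  have hTR' : T ∘ₗ R = LinearMap.id := LinearMap.ext hTR
  have hd : LinearMap.det T * LinearMap.det R = 1 := by
    rw [← LinearMap.det_comp, hTR', LinearMap.det_id]
  have key := det_ge_pow (R.adjoint ∘ₗ H ∘ₗ R) (hH.adjoint_conj R) c hc (by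
    intro x
    simp only [LinearMap.comp_apply, LinearMap.adjoint_inner_left]
    simpa [hTR] using h (R x))
  rw [LinearMap.det_comp, LinearMap.det_comp, det_adj] at key
  have h2 : 0 ≤ (LinearMap.det T) ^ 2 := sq_nonneg _
  calc _ ≤ LinearMap.det R * (LinearMap.det H * LinearMap.det R) * (LinearMap.det T) ^ 2 :=
        mul_le_mul_of_nonneg_right key h2
    _ = LinearMap.det H * (LinearMap.det T * LinearMap.det R) ^ 2 := by ring
    _ = _ := by rw [hd]; ring

lemma exists_diag_map (bs : Module.Basis (Fin n) ℝ (EE n)) :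
    ∃ d : ℝ, 0 < d ∧ ∀ y : Fin n → ℝ, (∀ i, 0 < y i) → ∃ T : EE n →ₗ[ℝ] EE n,
      (∀ x, ‖T x‖ ^ 2 = ∑ i, y i * ⟪bs i, x⟫ ^ 2) ∧ (LinearMap.det T) ^ 2 = d * ∏ i, y i := by
  let b := (EuclideanSpace.basisFun (Fin n) ℝ).toBasis
  let Q : Matrix (Fin n) (Fin n) ℝ := Matrix.of fun i j => bs i j
  let T : (Fin n → ℝ) → EE n →ₗ[ℝ] EE n := fun y => Matrix.toLin b b (Matrix.diagonal (fun i => √(y i)) * Q)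
  have hT : ∀ y x i, T y x i = √(y i) * ⟪bs i, x⟫ := by
    intro y x i
    have : T y x = ∑ j, ((Matrix.diagonal (fun i => √(y i)) * Q).mulVec (b.repr x)) j • b j :=
      Matrix.toLin_apply _ _ _ _
    rw [this]
    simp [b, Q, Matrix.mulVec, dotProduct, PiLp.inner_apply, Finset.mul_sum, mul_comm, mul_left_comm,
       Pi.single_apply]
  have hdet : ∀ y, LinearMap.det (T y) = (∏ i, √(y i)) * Q.det := by
    intro y; simp [T, LinearMap.det_toLin]
  have hnorm : ∀ y : Fin n → ℝ, (∀ i, 0 < y i) → ∀ x, ‖T y x‖ ^ 2 = ∑ i, y i * ⟪bs i, x⟫ ^ 2 := by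
    intro y hy x
    rw [EuclideanSpace.norm_sq_eq]
    refine Finset.sum_congr rfl fun i _ => ?_
    rw [hT, Real.norm_eq_abs, sq_abs, mul_pow, Real.sq_sqrt (hy i).le]
  have hQ : Q.det ≠ 0 := by
    intro h0
    have h1 : LinearMap.det (T fun _ => 1) = 0 := by rw [hdet, h0, mul_zero]
    obtain ⟨x, hx, hx0⟩ := Submodule.exists_mem_ne_zero_of_ne_bot (LinearMap.bot_lt_ker_of_det_eq_zero h1).ne'
    apply hx0
    apply InnerProductSpace.ext_inner_left_basis bs
    intro i
    have := hT (fun _ => 1) x i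
    rw [LinearMap.mem_ker.1 hx] at this
    simp at this
    simp [← this]
  refine ⟨Q.det ^ 2, by positivity, fun y hy => ⟨T y, hnorm y hy, ?_⟩⟩
  rw [hdet, mul_pow, ← Finset.prod_pow, mul_comm]
  congr 1
  exact Finset.prod_congr rfl fun i _ => Real.sq_sqrt (hy i).le

lemma qf_eq (A : Finset (EE n)) (w α β : EE n) :
    qf A w α = qf A w β * Real.exp ⟪α - β, w⟫ := by
  simp only [qf, inner_sub_left, Real.exp_sub]
  field_simp

/-- determinant lower bound for a fixed basis of differences. -/
lemma exists_det_lower (A : Finset (EE n)) (hA : A.Nonempty) (β : EE n) (hβ : β ∈ A)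
    (bs : Module.Basis (Fin n) ℝ (EE n)) (hbs : ∀ i, bs i + β ∈ A) :
    ∃ d : ℝ, 0 < d ∧ ∀ w, d * (qf A w β ^ 2) ^ n * ∏ i, Real.exp ⟪bs i, w⟫ ≤ (Hf A w).det := by
  obtain ⟨d, hd, h⟩ := exists_diag_map bs
  refine ⟨d, hd, fun w => ?_⟩
  obtain ⟨T, h1, h2⟩ := h (fun i => Real.exp ⟪bs i, w⟫) (fun i => Real.exp_pos _)
  have hp : 0 < d * ∏ i, Real.exp ⟪bs i, w⟫ := mul_pos hd (Finset.prod_pos fun _ _ => Real.exp_pos _)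
  have key := det_ge_of_form (Hf A w : EE n →ₗ[ℝ] EE n) T (Hf_symm hA w)
    (fun h0 => by rw [h0] at h2; norm_num at h2; rcases h2 with h2 | h2
                  · exact hd.ne' h2
                  · exact (Finset.prod_pos (fun i (_ : i ∈ Finset.univ) => Real.exp_pos ⟪bs i, w⟫)).ne' h2)
    (qf A w β ^ 2) (sq_nonneg _) (by
      intro x
      refine le_trans ?_ (inner_Hf_ge hA w x hβ)
      rw [sq (qf A w β), mul_assoc]
      refine mul_le_mul_of_nonneg_left ?_ (qf_pos hA w β).le
      rw [h1, Finset.mul_sum]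
      have : ∑ i, qf A w β * (Real.exp ⟪bs i, w⟫ * ⟪bs i, x⟫ ^ 2)
          = ∑ α ∈ Finset.univ.image (fun i => bs i + β), qf A w α * ⟪α - β, x⟫ ^ 2 := by
        rw [Finset.sum_image]
        · refine Finset.sum_congr rfl fun i _ => ?_
          rw [qf_eq A w (bs i + β) β]; simp [mul_assoc]
        · intro i _ j _ hij
          exact bs.injective (add_right_cancel hij)
      rw [this]
      apply Finset.sum_le_sum_of_subset_of_nonneg
      · intro α hα
        obtain ⟨i, _, rfl⟩ := Finset.mem_image.1 hα
        exact hbs i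
      · intro α _ _
        exact mul_nonneg (qf_pos hA w α).le (sq_nonneg _))
  rw [h2] at key
  calc _ = (qf A w β ^ 2) ^ n * (d * ∏ i, Real.exp ⟪bs i, w⟫) := by ring
    _ ≤ _ := key

end det

end

section
section integ
variable {n : ℕ}

lemma exists_basis_of_span (T : Set (EE n)) (hT : Submodule.span ℝ T = ⊤) :
    ∃ b : Fin n → EE n, (∀ i, b i ∈ T) ∧ LinearIndependent ℝ b := by
  obtain ⟨f, h1, h2, h3⟩ := Submodule.exists_fun_fin_finrank_span_eq ℝ T
  have hn : Module.finrank ℝ (Submodule.span ℝ T) = n := by rw [hT]; simp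
  exact ⟨f ∘ Fin.cast hn.symm, fun i => h1 _, h3.comp _ (Fin.cast_injective _)⟩

lemma span_diff (A : Finset (EE n)) (hspan : affineSpan ℝ (A : Set (EE n)) = ⊤) (β : EE n)
    (hβ : β ∈ A) : Submodule.span ℝ ((fun α => α - β) '' (A : Set (EE n))) = ⊤ := by
  have h1 := vectorSpan_eq_span_vsub_set_right ℝ (s := (A : Set (EE n))) (p := β) hβ
  rw [← direction_affineSpan, hspan, AffineSubspace.direction_top] at h1
  simpa using h1.symm

lemma exists_basis_diff (A : Finset (EE n)) (hspan : affineSpan ℝ (A : Set (EE n)) = ⊤) (β : EE n)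
    (hβ : β ∈ A) : ∃ bs : Module.Basis (Fin n) ℝ (EE n), ∀ i, bs i + β ∈ A := by
  obtain ⟨b, h1, h2⟩ := exists_basis_of_span _ (span_diff A hspan β hβ)
  refine ⟨basisOfLinearIndependentOfCardEqFinrank' b h2 (by simp), fun i => ?_⟩
  obtain ⟨α, hα, h⟩ := h1 i
  simp only [coe_basisOfLinearIndependentOfCardEqFinrank']
  rw [← h]; simpa using hα

lemma nonempty_of_span (A : Finset (EE n)) (hspan : affineSpan ℝ (A : Set (EE n)) = ⊤) :
    A.Nonempty := by
  rw [Finset.nonempty_iff_ne_empty]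
  rintro rfl
  simp at hspan

lemma det_Hf_pos (A : Finset (EE n)) (hspan : affineSpan ℝ (A : Set (EE n)) = ⊤) (w : EE n) :
    0 < (Hf A w).det := by
  have hA := nonempty_of_span A hspan
  obtain ⟨β, hβ⟩ := hA
  obtain ⟨bs, hbs⟩ := exists_basis_diff A hspan β hβ
  obtain ⟨d, hd, h⟩ := exists_det_lower A ⟨β, hβ⟩ β hβ bs hbs
  refine lt_of_lt_of_le ?_ (h w)
  have := qf_pos ⟨β, hβ⟩ w β
  have h2 := Finset.prod_pos (fun i (_ : i ∈ Finset.univ) => Real.exp_pos ⟪bs i, w⟫)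
  positivity

lemma inner_Hf_pos (A : Finset (EE n)) (hspan : affineSpan ℝ (A : Set (EE n)) = ⊤) (w h : EE n)
    (hh : h ≠ 0) : 0 < ⟪Hf A w h, h⟫ := by
  obtain ⟨β, hβ⟩ := nonempty_of_span A hspan
  have hA : A.Nonempty := ⟨β, hβ⟩
  refine lt_of_lt_of_le ?_ (inner_Hf_ge hA w h hβ)
  refine mul_pos (qf_pos hA w β) ?_
  apply Finset.sum_pos' (fun α _ => mul_nonneg (qf_pos hA w α).le (sq_nonneg _))
  by_contra hcon
  push Not at hcon
  apply hh
  obtain ⟨bs, hbs⟩ := exists_basis_diff A hspan β hβ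
  apply InnerProductSpace.ext_inner_left_basis bs
  intro i
  have h1 := hcon _ (hbs i)
  have h2 := qf_pos hA w (bs i + β)
  have h3 : ⟪bs i, h⟫ ^ 2 ≤ 0 := by
    rw [add_sub_cancel_right] at h1
    by_contra h4
    push Not at h4
    exact absurd h1 (not_le.2 (mul_pos h2 h4))
  have h4 : ⟪bs i, h⟫ = 0 := by nlinarith [sq_nonneg ⟪bs i, h⟫]
  rw [h4]; simp

lemma Gf_injective (A : Finset (EE n)) (hspan : affineSpan ℝ (A : Set (EE n)) = ⊤) :
    Function.Injective (Gf A) := by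
  have hA := nonempty_of_span A hspan
  intro x y hxy
  by_contra hne
  have hh : y - x ≠ 0 := sub_ne_zero.2 (Ne.symm hne)
  have hd : ∀ t : ℝ, HasDerivAt (fun t : ℝ => ⟪Gf A (x + t • (y - x)), y - x⟫)
      ⟪Hf A (x + t • (y - x)) (y - x), y - x⟫ t := by
    intro t
    have h1 : HasDerivAt (fun t : ℝ => x + t • (y - x)) (y - x) t := by
      simpa using ((hasDerivAt_id t).smul_const (y - x)).const_add x
    have h2 := (hasFDerivAt_Gf hA (x + t • (y - x))).comp_hasDerivAt t h1
    simpa using h2.inner ℝ (hasDerivAt_const t (y - x))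
  have hm : StrictMono (fun t : ℝ => ⟪Gf A (x + t • (y - x)), y - x⟫) := by
    apply strictMono_of_deriv_pos
    intro t
    rw [(hd t).deriv]
    exact inner_Hf_pos A hspan _ _ hh
  have := hm (zero_lt_one)
  simp [hxy] at this

lemma norm_Gf_le (A : Finset (EE n)) (hA : A.Nonempty) (v : EE n) : ‖Gf A v‖ ≤ ∑ α ∈ A, ‖α‖ := by
  unfold Gf
  refine (norm_sum_le _ _).trans (Finset.sum_le_sum fun α hα => ?_)
  rw [norm_smul, Real.norm_eq_abs, abs_of_pos (qf_pos hA v α)]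
  exact mul_le_of_le_one_left (norm_nonneg _) (qf_le_one hA v hα)

lemma integrable_det_Hf (A : Finset (EE n)) (hspan : affineSpan ℝ (A : Set (EE n)) = ⊤) :
    Integrable (fun w => (Hf A w).det) := by
  have hA := nonempty_of_span A hspan
  refine ⟨(continuous_det_Hf hA).aestronglyMeasurable, ?_⟩
  have h := lintegral_abs_det_fderiv_eq_addHaar_image volume MeasurableSet.univ
    (f := Gf A) (f' := Hf A) (fun x _ => (hasFDerivAt_Gf hA x).hasFDerivWithinAt)
    (Gf_injective A hspan).injOn
  rw [hasFiniteIntegral_iff_norm]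
  rw [setLIntegral_univ] at h
  simp only [Real.norm_eq_abs]
  rw [h]
  refine lt_of_le_of_lt (measure_mono ?_)
    (measure_closedBall_lt_top (x := (0 : EE n)) (r := ∑ α ∈ A, ‖α‖))
  rintro _ ⟨v, _, rfl⟩
  simpa using norm_Gf_le A hA v

lemma inner_le_lse (A : Finset (EE n)) {α : EE n} (hα : α ∈ A) (w : EE n) : ⟪α, w⟫ ≤ lse A w := by
  unfold lse
  rw [Real.le_log_iff_exp_le (Zf_pos ⟨α, hα⟩ w)]
  exact Finset.single_le_sum (f := fun α => Real.exp ⟪α, w⟫) (fun _ _ => (Real.exp_pos _).le) hα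

lemma inner_le_of_hull (A : Finset (EE n)) {p : EE n} (hp : p ∈ convexHull ℝ (A : Set (EE n)))
    (w : EE n) (c : ℝ) (h : ∀ α ∈ A, ⟪α, w⟫ ≤ c) : ⟪p, w⟫ ≤ c := by
  have hc : Convex ℝ {p : EE n | ⟪p, w⟫ ≤ c} := by
    apply convex_halfSpace_le
    exact ⟨fun x y => inner_add_left x y w, fun a x => by rw [real_inner_smul_left, smul_eq_mul]⟩
  exact convexHull_min (fun α hα => h α hα) hc hp

lemma integrable_term (A : Finset (EE n)) (hspan : affineSpan ℝ (A : Set (EE n)) = ⊤)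
    (χ : EE n → ℝ) (hχ : Continuous χ) (M : ℝ) (hM : ∀ x, |χ x| ≤ M) (k : ℕ) {p : EE n}
    (hp : p ∈ convexHull ℝ (A : Set (EE n))) :
    Integrable (fun w => Real.exp ((k : ℝ) * (⟪p, w⟫ - (lse A w + χ w))) * (Hf A w).det) := by
  have hA := nonempty_of_span A hspan
  refine (integrable_det_Hf A hspan).bdd_mul (c := Real.exp (k * M)) ?_ ?_
  · apply Continuous.aestronglyMeasurable
    exact (continuous_const.mul ((continuous_const.inner continuous_id).sub
      ((continuous_lse hA).add hχ))).rexp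
  · refine Eventually.of_forall fun w => ?_
    rw [Real.norm_eq_abs, abs_of_pos (Real.exp_pos _)]
    apply Real.exp_le_exp.2
    apply mul_le_mul_of_nonneg_left _ (Nat.cast_nonneg k)
    have := inner_le_of_hull A hp w _ (fun α hα => inner_le_lse A hα w)
    have h2 := (abs_le.1 (hM w)).1
    linarith

end integ

end

section
section partb
variable {n : ℕ}

lemma lse_le (A : Finset (EE n)) (hA : A.Nonempty) (w : EE n) (c : ℝ) (h : ∀ α ∈ A, ⟪α, w⟫ ≤ c) :
    lse A w ≤ Real.log A.card + c := by
  have hc : (0 : ℝ) < A.card := by exact_mod_cast hA.card_pos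
  unfold lse
  rw [Real.log_le_iff_le_exp (Zf_pos hA w), Real.exp_add, Real.exp_log hc]
  unfold Zf
  calc _ ≤ ∑ α ∈ A, Real.exp c := Finset.sum_le_sum fun α hα => Real.exp_le_exp.2 (h α hα)
    _ = _ := by simp

lemma mem_hull_of_affine_le (A : Finset (EE n)) (hA : A.Nonempty) (p : EE n) (c : ℝ)
    (h : ∀ w, ⟪p, w⟫ + c ≤ lse A w) : p ∈ convexHull ℝ (A : Set (EE n)) := by
  by_contra hp
  obtain ⟨f, u, h1, h2⟩ := geometric_hahn_banach_closed_point (convex_convexHull ℝ (A : Set (EE n)))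
    (A.finite_toSet.isClosed_convexHull (𝕜 := ℝ)) hp
  let d := (InnerProductSpace.toDual ℝ (EE n)).symm f
  have hd : ∀ x, ⟪x, d⟫ = f x := fun x => by
    rw [real_inner_comm]; exact InnerProductSpace.toDual_symm_apply
  have key : ∀ t : ℝ, 0 ≤ t → t * (f p - u) ≤ Real.log A.card - c := by
    intro t ht
    have h3 := h (t • d)
    have h4 := lse_le A hA (t • d) (t * u) (fun α hα => by
      rw [inner_smul_right, hd]
      exact mul_le_mul_of_nonneg_left (h1 α (subset_convexHull ℝ _ hα)).le ht)
    rw [inner_smul_right, hd] at h3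
    linarith
  have hpos : 0 < f p - u := sub_pos.2 h2
  have := key ((|Real.log A.card - c| + 1) / (f p - u)) (by positivity)
  rw [div_mul_cancel₀ _ hpos.ne'] at this
  linarith [le_abs_self (Real.log A.card - c)]

lemma round_point (A : Finset (EE n)) (hA : A.Nonempty)
    (hLat : ∀ α ∈ A, ∀ i, ∃ m : ℤ, α i = (m : ℝ)) (p₀ : EE n)
    (hp : p₀ ∈ convexHull ℝ (A : Set (EE n))) (k : ℕ) (hk : 1 ≤ k) :
    ∃ (p s : EE n) (ε : ℝ), 0 ≤ ε ∧ ε ≤ 1 ∧ ε * k ≤ (A.card : ℝ) ^ 2 ∧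
      s ∈ convexHull ℝ (A : Set (EE n)) ∧ p = (1 - ε) • p₀ + ε • s ∧
      ∀ i, ∃ m : ℤ, p i = (m : ℝ) / (k : ℝ) := by
  have hk0 : (0 : ℝ) < k := by exact_mod_cast hk
  have hm : (0 : ℝ) < A.card := by exact_mod_cast hA.card_pos
  rcases lt_or_ge (k : ℝ) ((A.card : ℝ) ^ 2) with hlt | hge
  · obtain ⟨α, hα⟩ := hA
    refine ⟨α, α, 1, by norm_num, le_rfl, by linarith, subset_convexHull ℝ _ hα, by simp, ?_⟩
    intro i
    obtain ⟨m, h⟩ := hLat α hα i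
    exact ⟨m * k, by rw [h]; push_cast; field_simp⟩
  obtain ⟨w, hw0, hw1, hwp⟩ := Finset.mem_convexHull'.1 hp
  obtain ⟨a, ha, hmax⟩ := A.exists_max_image w hA
  have hwa : 1 ≤ A.card * w a := by
    rw [← hw1]
    calc _ ≤ ∑ y ∈ A, w a := Finset.sum_le_sum fun y hy => hmax y hy
      _ = _ := by simp
  classical
  let c : EE n → ℤ := fun y => if y = a then k - ∑ z ∈ A.erase a, ⌈k * w z⌉ else ⌈k * w y⌉
  have hca : c a = k - ∑ z ∈ A.erase a, ⌈k * w z⌉ := by simp [c]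
  have hcy : ∀ y ∈ A.erase a, c y = ⌈k * w y⌉ := by
    intro y hy
    simp [c, Finset.ne_of_mem_erase hy]
  have hcsum : ∑ y ∈ A, (c y : ℝ) = k := by
    have h1 : ∑ y ∈ A.erase a, (c y : ℝ) = ∑ y ∈ A.erase a, (⌈k * w y⌉ : ℝ) :=
      Finset.sum_congr rfl fun y hy => by rw [hcy y hy]
    rw [← Finset.add_sum_erase A _ ha, hca, h1]
    push_cast; ring
  set ε : ℝ := (A.card : ℝ) ^ 2 / k with hε
  have hε0 : 0 < ε := by positivity
  have hεk : ε * k = (A.card : ℝ) ^ 2 := by rw [hε]; field_simp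
  have hge' : ∀ y ∈ A, 0 ≤ (c y : ℝ) / k - (1 - ε) * w y := by
    intro y hy
    have : k * ((1 - ε) * w y) ≤ c y := by
      by_cases hya : y = a
      · subst hya
        rw [hca]
        push_cast
        have h1 : ∑ z ∈ A.erase y, (⌈k * w z⌉ : ℝ) ≤ ∑ z ∈ A.erase y, (k * w z + 1) :=
          Finset.sum_le_sum fun z _ => (Int.ceil_lt_add_one _).le
        have h2 : ∑ z ∈ A.erase y, (k * w z + 1) = k * (1 - w y) + (A.card - 1) := by
          have h4 : ∑ z ∈ A.erase y, w z = 1 - w y := by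
            rw [← hw1, ← Finset.add_sum_erase A w hy]; ring
          rw [Finset.sum_add_distrib, ← Finset.mul_sum, h4]
          simp only [Finset.sum_const, Finset.card_erase_of_mem hy, nsmul_eq_mul, mul_one]
          rw [Nat.cast_sub (Finset.card_pos.2 ⟨y, hy⟩)]
          simp
        have h3 : k * ((1 - ε) * w y) = k * w y - (ε * k) * w y := by ring
        rw [h3, hεk]
        nlinarith
      · rw [hcy y (Finset.mem_erase.2 ⟨hya, hy⟩)]
        have h1 : (k : ℝ) * w y ≤ ⌈k * w y⌉ := Int.le_ceil _
        have h2 : 0 ≤ (k : ℝ) * w y := mul_nonneg hk0.le (hw0 y hy)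
        nlinarith
    rw [sub_nonneg, le_div_iff₀ hk0]
    linarith
  let s : EE n := ∑ y ∈ A, (((c y : ℝ) / k - (1 - ε) * w y) / ε) • y
  refine ⟨∑ y ∈ A, ((c y : ℝ) / k) • y, s, ε, hε0.le, ?_, hεk.le, ?_, ?_, ?_⟩
  · rw [hε, div_le_one hk0]; exact hge
  · refine Finset.mem_convexHull'.2 ⟨_, fun y hy => div_nonneg (hge' y hy) hε0.le, ?_, rfl⟩
    rw [← Finset.sum_div, Finset.sum_sub_distrib, ← Finset.sum_div, ← Finset.mul_sum, hcsum, hw1]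
    field_simp; ring
  · rw [← hwp, Finset.smul_sum, Finset.smul_sum, ← Finset.sum_add_distrib]
    refine Finset.sum_congr rfl fun y _ => ?_
    rw [smul_smul, smul_smul, ← add_smul]
    congr 1
    field_simp; ring
  · intro i
    choose! z hz using hLat
    refine ⟨∑ y ∈ A, c y * z y i, ?_⟩
    simp only [WithLp.ofLp_sum, WithLp.ofLp_smul, Finset.sum_apply, Pi.smul_apply, smul_eq_mul]
    push_cast
    rw [Finset.sum_div]
    refine Finset.sum_congr rfl fun y hy => ?_
    rw [hz y hy]; ring

lemma Nterm_pos (A : Finset (EE n)) (hspan : affineSpan ℝ (A : Set (EE n)) = ⊤)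
    (χ : EE n → ℝ) (hχ : Continuous χ) (M : ℝ) (hM : ∀ x, |χ x| ≤ M) (k : ℕ) {p : EE n}
    (hp : p ∈ convexHull ℝ (A : Set (EE n))) :
    0 < ∫ w, Real.exp ((k : ℝ) * (⟪p, w⟫ - (lse A w + χ w))) * (Hf A w).det := by
  have hpos : ∀ w, 0 < Real.exp ((k : ℝ) * (⟪p, w⟫ - (lse A w + χ w))) * (Hf A w).det :=
    fun w => mul_pos (Real.exp_pos _) (det_Hf_pos A hspan w)
  rw [integral_pos_iff_support_of_nonneg (fun w => (hpos w).le) (integrable_term A hspan χ hχ M hM k hp)]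
  have : Function.support (fun w => Real.exp ((k : ℝ) * (⟪p, w⟫ - (lse A w + χ w))) * (Hf A w).det)
      = Set.univ := by
    ext w; simp only [Function.mem_support, Set.mem_univ, iff_true]; exact (hpos w).ne'
  rw [this]
  exact IsOpen.measure_pos volume isOpen_univ Set.univ_nonempty

lemma part_b (A : Finset (EE n)) (hspan : affineSpan ℝ (A : Set (EE n)) = ⊤)
    (hLat : ∀ α ∈ A, ∀ i, ∃ m : ℤ, α i = (m : ℝ))
    (χ : EE n → ℝ) (hχ : Continuous χ) (M : ℝ) (hM : ∀ x, |χ x| ≤ M)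
    (φ : EE n → ℝ) (hφ : ∀ v, φ v = lse A v + χ v)
    (Λ : ℕ → Finset (EE n))
    (hΛ : ∀ k : ℕ, 1 ≤ k → ((Λ k : Set (EE n))
      = convexHull ℝ (A : Set (EE n)) ∩ {p | ∀ i, ∃ m : ℤ, p i = (m : ℝ) / (k : ℝ)}))
    (N : ℕ → EE n → ℝ)
    (hN : ∀ k p, N k p = ∫ w, Real.exp ((k : ℝ) * (⟪p, w⟫ - φ w)) * (Hf A w).det)
    (Ω : Set (EE n)) (hΩ : IsCompact Ω) :
    ∃ C > (0 : ℝ), ∀ k : ℕ, 1 ≤ k → ∀ v ∈ Ω,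
      C⁻¹ * Real.exp (-(k : ℝ) * (φ v - convEnv φ v)) ≤
        ∑ p ∈ Λ k, Real.exp ((k : ℝ) * (⟪p, v⟫ - φ v)) / N k p := by
  have hA := nonempty_of_span A hspan
  obtain rfl : φ = fun v => lse A v + χ v := funext hφ
  have hNpos : ∀ k p, p ∈ convexHull ℝ (A : Set (EE n)) → 0 < N k p := by
    intro k p hp; rw [hN]; exact Nterm_pos A hspan χ hχ M hM k hp
  set I := ∫ w, (Hf A w).det with hI
  have hIpos : 0 < I := by
    have := Nterm_pos A hspan χ hχ M hM 0 (p := hA.choose) (subset_convexHull ℝ _ hA.choose_spec)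
    simpa using this
  obtain ⟨D, hD⟩ : ∃ D, ∀ v ∈ Ω, lse A v + M + lse A (-v) + M ≤ D := by
    have hc : Continuous fun v => lse A v + M + lse A (-v) + M :=
      (((continuous_lse hA).add continuous_const).add ((continuous_lse hA).comp continuous_neg)).add
        continuous_const
    obtain ⟨D, hD⟩ := hΩ.bddAbove_image hc.continuousOn
    exact ⟨D, fun v hv => hD ⟨v, hv, rfl⟩⟩
  set C := I * Real.exp ((A.card : ℝ) ^ 2 * |D|) with hC
  have hCpos : 0 < C := by positivity
  refine ⟨C, hCpos, fun k hk v hv => ?_⟩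
  have hk0 : (0 : ℝ) < k := by exact_mod_cast hk
  set b := ∑ p ∈ Λ k, Real.exp ((k : ℝ) * (⟪p, v⟫ - (lse A v + χ v))) / N k p with hb
  have hmemΔ : ∀ p ∈ Λ k, p ∈ convexHull ℝ (A : Set (EE n)) := by
    intro p hp
    have : p ∈ (Λ k : Set (EE n)) := hp
    rw [hΛ k hk] at this
    exact this.1
  have hφΔ : ∀ s ∈ convexHull ℝ (A : Set (EE n)), ∀ w, ⟪s, w⟫ - (lse A w + χ w) ≤ M := by
    intro s hs w
    have := inner_le_of_hull A hs w _ (fun α hα => inner_le_lse A hα w)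
    have h2 := (abs_le.1 (hM w)).1
    linarith
  -- the key claim
  have key : ∀ (p₀ : EE n) (c₀ : ℝ), (∀ w, ⟪p₀, w⟫ + c₀ ≤ lse A w + χ w) →
      Real.exp (-(k : ℝ) * ((lse A v + χ v) - (⟪p₀, v⟫ + c₀))) ≤ C * b := by
    intro p₀ c₀ h
    have hp₀ : p₀ ∈ convexHull ℝ (A : Set (EE n)) := mem_hull_of_affine_le A hA p₀ (c₀ - M) (by
      intro w; have := h w; have h2 := (abs_le.1 (hM w)).2; linarith)
    obtain ⟨p, s, ε, hε0, hε1, hεk, hs, hps, hpi⟩ := round_point A hA hLat p₀ hp₀ k hk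
    have hpΔ : p ∈ convexHull ℝ (A : Set (EE n)) := by
      rw [hps]
      exact convex_convexHull ℝ _ hp₀ hs (by linarith) hε0 (by ring)
    have hpΛ : p ∈ Λ k := by
      have : p ∈ (Λ k : Set (EE n)) := by rw [hΛ k hk]; exact ⟨hpΔ, hpi⟩
      exact this
    set c' := (1 - ε) * (-c₀) + ε * M with hc'
    have hpw : ∀ w, ⟪p, w⟫ - (lse A w + χ w) ≤ c' := by
      intro w
      have h1 := h w
      have h2 := hφΔ s hs w
      rw [hps, inner_add_left, real_inner_smul_left, real_inner_smul_left]
      have h3 : (1 - ε) * (⟪p₀, w⟫ - (lse A w + χ w)) ≤ (1 - ε) * (-c₀) :=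
        mul_le_mul_of_nonneg_left (by linarith) (by linarith)
      have h4 := mul_le_mul_of_nonneg_left h2 hε0
      linarith
    have hNle : N k p ≤ Real.exp (k * c') * I := by
      rw [hN, hI, ← integral_const_mul]
      refine integral_mono (integrable_term A hspan χ hχ M hM k hpΔ)
        ((integrable_det_Hf A hspan).const_mul _) fun w => ?_
      refine mul_le_mul_of_nonneg_right ?_ (det_Hf_pos A hspan w).le
      exact Real.exp_le_exp.2 (mul_le_mul_of_nonneg_left (hpw w) hk0.le)
    have hterm : Real.exp ((k : ℝ) * (⟪p, v⟫ - (lse A v + χ v))) / N k p ≤ b :=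
      Finset.single_le_sum (f := fun p => Real.exp ((k : ℝ) * (⟪p, v⟫ - (lse A v + χ v))) / N k p)
        (fun q hq => div_nonneg (Real.exp_pos _).le (hNpos k q (hmemΔ q hq)).le) hpΛ
    have hterm2 : Real.exp ((k : ℝ) * (⟪p, v⟫ - (lse A v + χ v))) / (Real.exp (k * c') * I) ≤ b :=
      le_trans (div_le_div_of_nonneg_left (Real.exp_pos _).le (hNpos k p hpΔ) hNle) hterm
    rw [div_le_iff₀ (by positivity)] at hterm2
    have hfin : Real.exp (-(k : ℝ) * ((lse A v + χ v) - (⟪p₀, v⟫ + c₀))) ≤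
        Real.exp ((k : ℝ) * (⟪p, v⟫ - (lse A v + χ v))) * Real.exp (-(k * c')) *
          Real.exp ((A.card : ℝ) ^ 2 * |D|) := by
      rw [← Real.exp_add, ← Real.exp_add]
      apply Real.exp_le_exp.2
      have h1 : ⟪p, v⟫ - c' = (⟪p₀, v⟫ + c₀) - ε * (⟪p₀, v⟫ + c₀ - ⟪s, v⟫ + M) := by
        rw [hps, inner_add_left, real_inner_smul_left, real_inner_smul_left]; ring
      have h2 : ⟪p₀, v⟫ + c₀ - ⟪s, v⟫ + M ≤ |D| := by
        refine le_trans ?_ (le_abs_self D)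
        have h3 := h v
        have h4 := inner_le_of_hull A hs (-v) _ (fun α hα => inner_le_lse A hα (-v))
        rw [inner_neg_right] at h4
        have h5 := (abs_le.1 (hM v)).2
        have := hD v hv
        linarith
      have h3 : (ε * k) * (⟪p₀, v⟫ + c₀ - ⟪s, v⟫ + M) ≤ (A.card : ℝ) ^ 2 * |D| :=
        (mul_le_mul_of_nonneg_left h2 (by positivity)).trans
          (mul_le_mul_of_nonneg_right hεk (abs_nonneg D))
      have h4 : (k : ℝ) * (⟪p, v⟫ - c') = k * (⟪p₀, v⟫ + c₀) - (ε * k) * (⟪p₀, v⟫ + c₀ - ⟪s, v⟫ + M) := by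
        rw [h1]; ring
      linarith
    refine hfin.trans ?_
    calc _ ≤ b * (Real.exp (k * c') * I) * Real.exp (-(k * c')) * Real.exp ((A.card : ℝ) ^ 2 * |D|) := by
          gcongr
      _ = C * b * (Real.exp (k * c') * Real.exp (-(k * c'))) := by rw [hC]; ring
      _ = C * b := by rw [← Real.exp_add]; simp
  have hαw : ∀ α ∈ A, ∀ w, ⟪α, w⟫ + (-M) ≤ lse A w + χ w := by
    intro α hα w
    have := hφΔ α (subset_convexHull ℝ _ hα) w
    linarith
  have hbpos : 0 < C * b :=
    lt_of_lt_of_le (Real.exp_pos _) (key _ _ (hαw _ hA.choose_spec))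
  have hlog : ∀ a : ℝ, Real.exp (-(k : ℝ) * ((lse A v + χ v) - a)) ≤ C * b ↔
      a ≤ (lse A v + χ v) + Real.log (C * b) / k := by
    intro a
    rw [← Real.le_log_iff_exp_le hbpos, ← sub_le_iff_le_add', le_div_iff₀ hk0]
    constructor <;> intro h <;> linarith
  rw [inv_mul_le_iff₀ hCpos, hlog]
  unfold convEnv
  apply csSup_le
  · exact ⟨_, fun w => ⟪hA.choose, w⟫ + (-M), ⟨convex_univ, fun x _ y _ a b _ _ hab => by
      simp only [inner_add_right, inner_smul_right, smul_eq_mul]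
      have : a * M + b * M = M := by rw [← add_mul, hab, one_mul]
      linarith⟩, hαw _ hA.choose_spec, rfl⟩
  · rintro _ ⟨g, hg, hgle, rfl⟩
    apply le_of_forall_lt
    intro a' ha'
    obtain ⟨a, ha1, ha2⟩ := exists_between ha'
    refine lt_of_lt_of_le ha1 ?_
    obtain ⟨l, c, h1, h2⟩ := hg.exists_affine_le_of_lt (𝕜 := ℝ) (Set.mem_univ v) ha2 isClosed_univ
      (hg.locallyLipschitz.continuous.lowerSemicontinuous.lowerSemicontinuousOn _)
    let d := (InnerProductSpace.toDual ℝ (EE n)).symm l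
    have hd : ∀ x, ⟪d, x⟫ = l x := fun x => InnerProductSpace.toDual_symm_apply
    have h3 := key d c (fun w => by
      have := h1 ⟨w, Set.mem_univ w⟩
      simp at this
      rw [hd]
      exact this.trans (hgle w))
    rw [hlog, hd] at h3
    simp at h2
    rw [h2] at h3
    exact h3

end partb

end

section
section local_bounds
variable {n : ℕ}

lemma exp_le_quad {x : ℝ} (h : |x| ≤ 1) : Real.exp x ≤ 1 + x + x ^ 2 := by
  have := Real.abs_exp_sub_one_sub_id_le h
  have := (abs_le.1 this).2
  linarith

lemma taylor_lse (A : Finset (EE n)) (hA : A.Nonempty) (β v u : EE n)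
    (h : ∀ α ∈ A, |⟪α - β, u⟫| ≤ 1) :
    lse A (v + u) ≤ lse A v + ⟪Gf A v, u⟫ + ∑ α ∈ A, qf A v α * ⟪α - β, u⟫ ^ 2 := by
  have hZ := Zf_pos hA v
  set S := ∑ α ∈ A, qf A v α * Real.exp ⟪α - β, u⟫ with hS
  have hSpos : 0 < S := Finset.sum_pos (fun α _ => mul_pos (qf_pos hA v α) (Real.exp_pos _)) hA
  have h1 : Zf A (v + u) = Zf A v * (Real.exp ⟪β, u⟫ * S) := by
    rw [hS, Finset.mul_sum, Finset.mul_sum]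
    unfold Zf
    refine Finset.sum_congr rfl fun α _ => ?_
    unfold qf
    have : Zf A v ≠ 0 := hZ.ne'
    rw [show (∑ α ∈ A, Real.exp ⟪α, v⟫) = Zf A v from rfl, inner_add_right, inner_sub_left,
      Real.exp_add, Real.exp_sub]
    field_simp
  have h2 : S ≤ 1 + (⟪Gf A v, u⟫ - ⟪β, u⟫) + ∑ α ∈ A, qf A v α * ⟪α - β, u⟫ ^ 2 := by
    calc S ≤ ∑ α ∈ A, qf A v α * (1 + ⟪α - β, u⟫ + ⟪α - β, u⟫ ^ 2) :=
          Finset.sum_le_sum fun α hα => mul_le_mul_of_nonneg_left (exp_le_quad (h α hα)) (qf_pos hA v α).le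
      _ = ∑ α ∈ A, (qf A v α * (1 - ⟪β, u⟫) + qf A v α * ⟪α, u⟫ + qf A v α * ⟪α - β, u⟫ ^ 2) := by
          refine Finset.sum_congr rfl fun α _ => ?_
          rw [inner_sub_left]; ring
      _ = _ := by
          rw [Finset.sum_add_distrib, Finset.sum_add_distrib, ← Finset.sum_mul, sum_qf hA, inner_Gf]
          ring
  unfold lse
  rw [h1, Real.log_mul hZ.ne' (by positivity), Real.log_mul (by positivity) hSpos.ne', Real.log_exp]
  have := Real.log_le_sub_one_of_pos hSpos
  linarith

lemma taylor_chi (χ : EE n → ℝ) (hχ : ContDiff ℝ (⊤ : ℕ∞) χ) (hc : HasCompactSupport χ) :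
    ∃ L : ℝ, 0 ≤ L ∧ ∀ v u, χ (v + u) ≤ χ v + fderiv ℝ χ v u + L * ‖u‖ ^ 2 := by
  obtain ⟨C, hC⟩ := ContDiff.lipschitzWith_of_hasCompactSupport (𝕂 := ℝ) (f := fderiv ℝ χ) (n := 1)
    (hc.fderiv ℝ) (hχ.fderiv_right (by norm_cast)) (by norm_num)
  refine ⟨C, C.2, fun v u => ?_⟩
  have hd : Differentiable ℝ χ := hχ.differentiable (by simp)
  have h := Convex.norm_image_sub_le_of_norm_hasFDerivWithin_le' (f := χ) (f' := fderiv ℝ χ)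
    (φ := fderiv ℝ χ v) (s := Metric.closedBall v ‖u‖) (C := C * ‖u‖) (x := v) (y := v + u)
    (fun x _ => (hd x).hasFDerivAt.hasFDerivWithinAt) ?_ (convex_closedBall _ _)
    (by simp) (by simp)
  · rw [add_sub_cancel_left, Real.norm_eq_abs] at h
    have := (abs_le.1 h).2
    rw [sq, ← mul_assoc]; linarith
  · intro x hx
    have := hC.dist_le_mul x v
    rw [dist_eq_norm] at this
    exact this.trans (mul_le_mul_of_nonneg_left (by simpa using hx) C.2)

/-- good point: dominated by the vertex and basis -/
def Good (A : Finset (EE n)) (β : EE n) (bs : Module.Basis (Fin n) ℝ (EE n)) (k : ℕ) (v : EE n) : Prop :=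
  (∀ α ∈ A, ⟪α - β, v⟫ ≤ 0) ∧ (∀ i, -Real.log k ≤ ⟪bs i, v⟫) ∧
  (∀ α ∈ A, ∀ i, bs.repr (α - β) i ≠ 0 → ⟪α - β, v⟫ ≤ ⟪bs i, v⟫)

lemma norm_le_of_basis (bs : Module.Basis (Fin n) ℝ (EE n)) :
    ∃ K : ℝ, 0 ≤ K ∧ ∀ (u : EE n) (r : ℝ), 0 ≤ r → (∀ i, |⟪bs i, u⟫| ≤ r) → ‖u‖ ≤ K * r := by
  let F : EE n →ₗ[ℝ] (Fin n → ℝ) := LinearMap.pi fun i => (innerSL ℝ (bs i)).toLinearMap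
  have hF : ∀ u i, F u i = ⟪bs i, u⟫ := fun u i => rfl
  have hker : LinearMap.ker F = ⊥ := by
    rw [LinearMap.ker_eq_bot']
    intro u hu
    apply InnerProductSpace.ext_inner_left_basis bs
    intro i
    rw [inner_zero_right, ← hF, hu]; rfl
  obtain ⟨K, hK, h⟩ := F.exists_antilipschitzWith hker
  refine ⟨K, K.2, fun u r hr hu => ?_⟩
  have h1 := h.le_mul_dist u 0
  rw [dist_zero_right, map_zero, dist_zero_right] at h1
  refine h1.trans (mul_le_mul_of_nonneg_left ?_ K.2)
  rw [pi_norm_le_iff_of_nonneg hr]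
  exact hu

lemma local_bound (A : Finset (EE n)) (hA : A.Nonempty) (χ : EE n → ℝ)
    (hχ : ContDiff ℝ (⊤ : ℕ∞) χ) (hc : HasCompactSupport χ) (β : EE n) (hβ : β ∈ A)
    (bs : Module.Basis (Fin n) ℝ (EE n)) (hbs : ∀ i, bs i + β ∈ A) :
    ∃ δ > (0 : ℝ), ∃ c > (0 : ℝ), ∃ E : ℝ, δ ≤ 1 ∧ ∀ k : ℕ, 1 ≤ k → ∀ v, Good A β bs k v → ∀ u,
      (∀ i, |⟪bs i, u⟫| ≤ δ / √(k * Real.exp ⟪bs i, v⟫)) →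
      (lse A (v + u) + χ (v + u) ≤ lse A v + χ v + (⟪Gf A v, u⟫ + fderiv ℝ χ v u) + E / k) ∧
      c * ∏ i, Real.exp ⟪bs i, v⟫ ≤ (Hf A (v + u)).det := by
  obtain ⟨L, hL0, hL⟩ := taylor_chi χ hχ hc
  obtain ⟨K, hK0, hK⟩ := norm_le_of_basis bs
  obtain ⟨d, hd, hdet⟩ := exists_det_lower A hA β hβ bs hbs
  set R : ℝ := 1 + ∑ α ∈ A, ∑ i, |bs.repr (α - β) i| with hR
  have hR1 : 1 ≤ R := by
    have : 0 ≤ ∑ α ∈ A, ∑ i, |bs.repr (α - β) i| :=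
      Finset.sum_nonneg fun _ _ => Finset.sum_nonneg fun _ _ => abs_nonneg _
    linarith
  have hRα : ∀ α ∈ A, ∑ i, |bs.repr (α - β) i| ≤ R := by
    intro α hα
    have := Finset.single_le_sum (f := fun α => ∑ i, |bs.repr (α - β) i|)
      (fun _ _ => Finset.sum_nonneg fun _ _ => abs_nonneg _) hα
    linarith
  have hR0 : 0 < R := by linarith
  obtain ⟨R0, hR0b⟩ := hc.isCompact.isBounded.exists_norm_le
  set R1 : ℝ := |R0| + K with hR1d
  set y0 : ℝ := Real.exp (-((∑ i, ‖bs i‖) * R1)) with hy0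
  have hy0p : 0 < y0 := Real.exp_pos _
  obtain ⟨m, hm⟩ : ∃ m : ℝ, m = (A.card : ℝ) := ⟨_, rfl⟩
  have hmp : 0 < m := by rw [hm]; exact_mod_cast hA.card_pos
  refine ⟨1 / R, by positivity, d * (((m * Real.exp 1)⁻¹) ^ 2) ^ n * Real.exp (-1) ^ n, by positivity,
    m + L * K ^ 2 / y0, (div_le_one hR0).2 hR1, ?_⟩
  intro k hk v hv u hu
  obtain ⟨g1, g2, g3⟩ := hv
  have hk0 : (0 : ℝ) < k := by exact_mod_cast hk
  have hky : ∀ i, 1 ≤ k * Real.exp ⟪bs i, v⟫ := by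
    intro i
    have := Real.exp_le_exp.2 (g2 i)
    rw [Real.exp_neg, Real.exp_log hk0] at this
    calc (1 : ℝ) = k * (k : ℝ)⁻¹ := by field_simp
      _ ≤ _ := by gcongr
  have hu1 : ∀ i, |⟪bs i, u⟫| ≤ 1 / R := fun i => (hu i).trans
    (div_le_self (by positivity) (Real.one_le_sqrt.2 (hky i)))
  have hexp : ∀ x : EE n, ∀ w, ⟪x, w⟫ = ∑ i, bs.repr x i * ⟪bs i, w⟫ := by
    intro x w
    conv_lhs => rw [← bs.sum_repr x]
    rw [sum_inner]
    simp only [real_inner_smul_left]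
  have hx1 : ∀ α ∈ A, |⟪α - β, u⟫| ≤ 1 := by
    intro α hα
    rw [hexp]
    refine (Finset.abs_sum_le_sum_abs _ _).trans ?_
    calc _ ≤ ∑ i, |bs.repr (α - β) i| * (1 / R) := Finset.sum_le_sum fun i _ => by
          rw [abs_mul]; exact mul_le_mul_of_nonneg_left (hu1 i) (abs_nonneg _)
      _ ≤ R * (1 / R) := by rw [← Finset.sum_mul]; gcongr; exact hRα α hα
      _ = 1 := by field_simp
  have hx2 : ∀ α ∈ A, |⟪α - β, u⟫| ≤ 1 / √(k * Real.exp ⟪α - β, v⟫) := by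
    intro α hα
    rw [hexp (α - β) u]
    refine (Finset.abs_sum_le_sum_abs _ _).trans ?_
    calc _ ≤ ∑ i, |bs.repr (α - β) i| * ((1 / R) / √(k * Real.exp ⟪α - β, v⟫)) :=
          Finset.sum_le_sum fun i _ => by
            rw [abs_mul]
            by_cases h0 : bs.repr (α - β) i = 0
            · rw [h0, abs_zero, zero_mul, zero_mul]
            · refine mul_le_mul_of_nonneg_left ((hu i).trans ?_) (abs_nonneg _)
              have := g3 α hα i h0
              gcongr
      _ ≤ R * ((1 / R) / √(k * Real.exp ⟪α - β, v⟫)) := by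
          rw [← Finset.sum_mul]; gcongr; exact hRα α hα
      _ = _ := by field_simp
  have hq : ∀ α ∈ A, qf A v α * ⟪α - β, u⟫ ^ 2 ≤ 1 / k := by
    intro α hα
    have h1 : ⟪α - β, u⟫ ^ 2 ≤ 1 / (k * Real.exp ⟪α - β, v⟫) := by
      rw [← sq_abs]
      calc _ ≤ (1 / √(k * Real.exp ⟪α - β, v⟫)) ^ 2 := by gcongr; exact hx2 α hα
        _ = _ := by rw [div_pow, Real.sq_sqrt (by positivity)]; simp
    have h2 : qf A v α ≤ Real.exp ⟪α - β, v⟫ := by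
      rw [qf_eq A v α β]
      exact mul_le_of_le_one_left (Real.exp_pos _).le (qf_le_one hA v hβ)
    calc _ ≤ Real.exp ⟪α - β, v⟫ * (1 / (k * Real.exp ⟪α - β, v⟫)) := by gcongr
      _ = _ := by field_simp
  constructor
  · have h1 := taylor_lse A hA β v u hx1
    have h2 : ∑ α ∈ A, qf A v α * ⟪α - β, u⟫ ^ 2 ≤ m / k := by
      calc _ ≤ ∑ α ∈ A, 1 / (k : ℝ) := Finset.sum_le_sum hq
        _ = _ := by rw [Finset.sum_const, nsmul_eq_mul, hm]; ring
    have h3 : χ (v + u) ≤ χ v + fderiv ℝ χ v u + (L * K ^ 2 / y0) / k := by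
      have hnu : ‖u‖ ≤ K := by
        have := hK u 1 (by norm_num) (fun i => (hu1 i).trans ((div_le_one hR0).2 hR1))
        linarith
      by_cases hout : v ∉ tsupport χ ∧ v + u ∉ tsupport χ
      · have e1 : χ v = 0 := image_eq_zero_of_notMem_tsupport hout.1
        have e2 : χ (v + u) = 0 := image_eq_zero_of_notMem_tsupport hout.2
        have e3 : fderiv ℝ χ v = 0 :=
          image_eq_zero_of_notMem_tsupport (fun h => hout.1 (tsupport_fderiv_subset ℝ h))
        rw [e1, e2, e3]
        simp
        positivity
      · have hvn : ‖v‖ ≤ R1 := by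
          by_cases hv1 : v ∈ tsupport χ
          · have := hR0b v hv1
            have := le_abs_self R0
            linarith
          · have hv2 : v + u ∈ tsupport χ := by
              by_contra h; exact hout ⟨hv1, h⟩
            have e1 := hR0b _ hv2
            have e2 := le_abs_self R0
            have e3 : ‖v‖ ≤ ‖v + u‖ + ‖u‖ := by
              calc ‖v‖ = ‖(v + u) - u‖ := by simp
                _ ≤ _ := norm_sub_le _ _
            linarith
        have hyi : ∀ i, y0 ≤ Real.exp ⟪bs i, v⟫ := by
          intro i
          apply Real.exp_le_exp.2
          have e1 := (abs_le.1 (abs_real_inner_le_norm (bs i) v)).1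
          have e2 : ‖bs i‖ * ‖v‖ ≤ (∑ i, ‖bs i‖) * R1 := by
            apply mul_le_mul _ hvn (norm_nonneg _) (Finset.sum_nonneg fun _ _ => norm_nonneg _)
            exact Finset.single_le_sum (f := fun i => ‖bs i‖) (fun _ _ => norm_nonneg _) (Finset.mem_univ i)
          linarith
        have hu2 := hK u (1 / √(k * y0)) (by positivity) (fun i => (hu i).trans (by
          have := hyi i
          have h5 : 1 / R ≤ 1 := (div_le_one hR0).2 hR1
          gcongr))
        have hu3 : ‖u‖ ^ 2 ≤ K ^ 2 / y0 / k := by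
          calc ‖u‖ ^ 2 ≤ (K * (1 / √(k * y0))) ^ 2 := by gcongr
            _ = _ := by
              rw [mul_pow, div_pow, Real.sq_sqrt (by positivity)]
              field_simp
        have := hL v u
        have h6 : L * ‖u‖ ^ 2 ≤ L * (K ^ 2 / y0 / k) := mul_le_mul_of_nonneg_left hu3 hL0
        have h7 : L * (K ^ 2 / y0 / k) = (L * K ^ 2 / y0) / k := by ring
        linarith
    rw [add_div]
    linarith
  · refine le_trans ?_ (hdet (v + u))
    have h1 : (m * Real.exp 1)⁻¹ ≤ qf A (v + u) β := by
      have hZ := Zf_pos hA (v + u)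
      unfold qf
      rw [inv_le_comm₀ (by positivity) (by positivity), inv_div, div_le_iff₀ (Real.exp_pos _)]
      unfold Zf
      calc _ ≤ ∑ α ∈ A, Real.exp 1 * Real.exp ⟪β, v + u⟫ := by
            refine Finset.sum_le_sum fun α hα => ?_
            rw [← Real.exp_add]
            apply Real.exp_le_exp.2
            have e1 := g1 α hα
            have e2 := (abs_le.1 (hx1 α hα)).2
            have e3 : ⟪α, v + u⟫ = ⟪β, v + u⟫ + ⟪α - β, v⟫ + ⟪α - β, u⟫ := by
              simp only [inner_add_right, inner_sub_left]; ring
            linarith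
        _ = _ := by rw [Finset.sum_const, nsmul_eq_mul, hm]; ring
    have h2 : Real.exp (-1) ^ n * ∏ i, Real.exp ⟪bs i, v⟫ ≤ ∏ i, Real.exp ⟪bs i, v + u⟫ := by
      have : Real.exp (-1) ^ n = ∏ i : Fin n, Real.exp (-1) := by simp
      rw [this, ← Finset.prod_mul_distrib]
      refine Finset.prod_le_prod (fun i _ => by positivity) fun i _ => ?_
      rw [← Real.exp_add]
      apply Real.exp_le_exp.2
      have e1 := (abs_le.1 ((hu1 i).trans ((div_le_one hR0).2 hR1))).1
      rw [inner_add_right]; linarith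
    rw [mul_assoc]
    have h3 : 0 ≤ ∏ i, Real.exp ⟪bs i, v⟫ := Finset.prod_nonneg fun _ _ => (Real.exp_pos _).le
    gcongr

end local_bounds

end

section
section nlower
variable {n : ℕ}

lemma box_volume (bs : Module.Basis (Fin n) ℝ (EE n)) :
    ∃ κ > (0 : ℝ), ∀ l r : Fin n → ℝ, l ≤ r →
      MeasurableSet {w : EE n | ∀ i, ⟪bs i, w⟫ ∈ Set.Icc (l i) (r i)} ∧
      volume {w : EE n | ∀ i, ⟪bs i, w⟫ ∈ Set.Icc (l i) (r i)} ≠ ⊤ ∧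
      volume.real {w : EE n | ∀ i, ⟪bs i, w⟫ ∈ Set.Icc (l i) (r i)} = κ * ∏ i, (r i - l i) := by
  let F : EE n →ₗ[ℝ] (Fin n → ℝ) := LinearMap.pi fun i => (innerSL ℝ (bs i)).toLinearMap
  have hF : ∀ u i, F u i = ⟪bs i, u⟫ := fun u i => rfl
  have hker : LinearMap.ker F = ⊥ := by
    rw [LinearMap.ker_eq_bot']
    intro u hu
    apply InnerProductSpace.ext_inner_left_basis bs
    intro i
    rw [inner_zero_right, ← hF, hu]; rfl
  let e : EE n ≃ₗ[ℝ] (Fin n → ℝ) :=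
    LinearEquiv.ofInjectiveOfFinrankEq F (LinearMap.ker_eq_bot.1 hker) (by simp)
  let G := e.toContinuousLinearEquiv
  have hG : ∀ u i, G u i = ⟪bs i, u⟫ := fun u i => rfl
  have hH : Measure.IsAddHaarMeasure ((volume : Measure (EE n)).map G) := G.isAddHaarMeasure_map volume
  set c := Measure.addHaarScalarFactor ((volume : Measure (EE n)).map G) (volume : Measure (Fin n → ℝ)) with hc
  have hcpos : 0 < c := Measure.addHaarScalarFactor_pos_of_isAddHaarMeasure _ _
  have hmap : (volume : Measure (EE n)).map G = c • (volume : Measure (Fin n → ℝ)) :=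
    Measure.isAddLeftInvariant_eq_smul _ _
  refine ⟨c, by exact_mod_cast hcpos, fun l r hlr => ?_⟩
  have hset : {w : EE n | ∀ i, ⟪bs i, w⟫ ∈ Set.Icc (l i) (r i)} = G ⁻¹' (Set.Icc l r) := by
    ext w
    simp only [Set.mem_ofPred_eq, Set.mem_preimage, Set.mem_Icc, Pi.le_def, hG]
    exact forall_and
  have hm : MeasurableSet (G ⁻¹' (Set.Icc l r)) := G.continuous.measurable measurableSet_Icc
  have hv : volume (G ⁻¹' (Set.Icc l r)) = c • volume (Set.Icc l r) := by
    rw [← Measure.map_apply G.continuous.measurable measurableSet_Icc, hmap]; rfl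
  rw [hset]
  have hfin : volume (Set.Icc l r) ≠ ⊤ := isCompact_Icc.measure_lt_top.ne
  refine ⟨hm, ?_, ?_⟩
  · rw [hv]
    exact ENNReal.mul_ne_top ENNReal.coe_ne_top hfin
  · rw [Measure.real, hv, ← Real.volume_Icc_pi_toReal hlr]
    rw [ENNReal.smul_def, smul_eq_mul, ENNReal.toReal_mul]; rfl

lemma N_lower (A : Finset (EE n)) (hspan : affineSpan ℝ (A : Set (EE n)) = ⊤) (χ : EE n → ℝ)
    (hχ : ContDiff ℝ (⊤ : ℕ∞) χ) (hc : HasCompactSupport χ) (M : ℝ) (hM : ∀ x, |χ x| ≤ M)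
    (β : EE n) (hβ : β ∈ A)
    (bs : Module.Basis (Fin n) ℝ (EE n)) (hbs : ∀ i, bs i + β ∈ A) :
    ∃ δ > (0 : ℝ), ∃ c > (0 : ℝ), δ ≤ 1 ∧ ∀ k : ℕ, 1 ≤ k → ∀ v, Good A β bs k v → ∃ m : EE n,
      ∀ p ∈ convexHull ℝ (A : Set (EE n)),
      c * Real.exp (k * (⟪p, v⟫ - (lse A v + χ v))) *
        (∏ i, (Real.exp ⟪bs i, v⟫ * (δ / √(k * Real.exp ⟪bs i, v⟫)))) *
        ∏ i, Real.exp (k * (|bs.repr (p - m) i| * (δ / √(k * Real.exp ⟪bs i, v⟫) / 2))) ≤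
      ∫ w, Real.exp ((k : ℝ) * (⟪p, w⟫ - (lse A w + χ w))) * (Hf A w).det := by
  have hA : A.Nonempty := ⟨β, hβ⟩
  obtain ⟨δ, hδ, c, hc0, E, hδ1, H⟩ := local_bound A hA χ hχ hc β hβ bs hbs
  obtain ⟨κ, hκ, hbox⟩ := box_volume bs
  refine ⟨δ, hδ, c * Real.exp (-E) * κ * (1 / 2) ^ n, by positivity, hδ1, fun k hk v hv => ?_⟩
  have hk0 : (0 : ℝ) < k := by exact_mod_cast hk
  let m := Gf A v + (InnerProductSpace.toDual ℝ (EE n)).symm (fderiv ℝ χ v)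
  have hm : ∀ u, ⟪m, u⟫ = ⟪Gf A v, u⟫ + fderiv ℝ χ v u := by
    intro u
    rw [inner_add_left, InnerProductSpace.toDual_symm_apply]
  refine ⟨m, fun p hp => ?_⟩
  obtain ⟨d, hd⟩ : ∃ d : Fin n → ℝ, d = fun i => δ / √(k * Real.exp ⟪bs i, v⟫) := ⟨_, rfl⟩
  have hdi : ∀ i, δ / √(k * Real.exp ⟪bs i, v⟫) = d i := fun i => by rw [hd]
  have hd0 : ∀ i, 0 < d i := fun i => by rw [hd]; positivity
  simp only [hdi] at H ⊢
  have H2 := H k hk v hv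
  simp only [hdi] at H2
  obtain ⟨cp, hcp⟩ : ∃ cp : Fin n → ℝ, cp = fun i => bs.repr (p - m) i := ⟨_, rfl⟩
  have hcpi : ∀ i, bs.repr (p - m) i = cp i := fun i => by rw [hcp]
  simp only [hcpi]
  let l : Fin n → ℝ := fun i => ⟪bs i, v⟫ + if 0 ≤ cp i then d i / 2 else -d i
  let r : Fin n → ℝ := fun i => ⟪bs i, v⟫ + if 0 ≤ cp i then d i else -(d i / 2)
  have hrl : ∀ i, r i - l i = d i / 2 := by
    intro i; simp only [r, l]; split_ifs <;> ring
  have hlr : l ≤ r := fun i => by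
    have := hrl i; have := hd0 i; linarith
  obtain ⟨b1, b2, b3⟩ := hbox l r hlr
  set U := {w : EE n | ∀ i, ⟪bs i, w⟫ ∈ Set.Icc (l i) (r i)} with hU
  have hLat := integrable_term A hspan χ hχ.continuous M hM k hp
  have hpos : ∀ w, 0 < Real.exp ((k : ℝ) * (⟪p, w⟫ - (lse A w + χ w))) * (Hf A w).det :=
    fun w => mul_pos (Real.exp_pos _) (det_Hf_pos A hspan w)
  set P := ∏ i, Real.exp ⟪bs i, v⟫ with hP
  set S := ∑ i, |cp i| * (d i / 2) with hS
  have hP0 : 0 < P := Finset.prod_pos fun _ _ => Real.exp_pos _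
  have hlow : ∀ w ∈ U, Real.exp (k * (⟪p, v⟫ - (lse A v + χ v))) * Real.exp (k * S) * Real.exp (-E) * (c * P)
      ≤ Real.exp ((k : ℝ) * (⟪p, w⟫ - (lse A w + χ w))) * (Hf A w).det := by
    intro w hw
    obtain ⟨u, rfl⟩ : ∃ u, w = v + u := ⟨w - v, by simp⟩
    have hw' : ∀ i, (0 ≤ cp i → d i / 2 ≤ ⟪bs i, u⟫ ∧ ⟪bs i, u⟫ ≤ d i) ∧
        (¬ 0 ≤ cp i → -d i ≤ ⟪bs i, u⟫ ∧ ⟪bs i, u⟫ ≤ -(d i / 2)) := by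
      intro i
      have := hw i
      simp only [l, r, inner_add_right, Set.mem_Icc] at this
      constructor <;> intro h <;> simp only [h, if_true, if_false] at this <;>
        exact ⟨by linarith [this.1], by linarith [this.2]⟩
    have hub : ∀ i, |⟪bs i, u⟫| ≤ d i := by
      intro i
      have h0 := hd0 i
      rw [abs_le]
      by_cases h : 0 ≤ cp i
      · have := (hw' i).1 h
        constructor <;> linarith [this.1, this.2]
      · have := (hw' i).2 h
        constructor <;> linarith [this.1, this.2]
    obtain ⟨e1, e2⟩ := H2 u hub
    have e3 : S ≤ ⟪p - m, u⟫ := by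
      conv_rhs => rw [← bs.sum_repr (p - m)]
      rw [sum_inner]
      refine Finset.sum_le_sum fun i _ => ?_
      rw [real_inner_smul_left, hcpi]
      by_cases h : 0 ≤ cp i
      · rw [abs_of_nonneg h]
        exact mul_le_mul_of_nonneg_left ((hw' i).1 h).1 h
      · have h' := not_le.1 h
        rw [abs_of_neg h']
        have := ((hw' i).2 h).2
        nlinarith
    have e4 : k * (⟪p, v⟫ - (lse A v + χ v)) + k * S + -E ≤ k * (⟪p, v + u⟫ - (lse A (v + u) + χ (v + u))) := by
      rw [inner_sub_left, hm] at e3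
      rw [inner_add_right]
      have : k * (⟪p, v⟫ - (lse A v + χ v)) + k * S + -E = k * (⟪p, v⟫ - (lse A v + χ v) + S - E / k) := by
        field_simp
        ring
      rw [this]
      apply mul_le_mul_of_nonneg_left _ hk0.le
      linarith
    rw [← Real.exp_add, ← Real.exp_add]
    apply mul_le_mul (Real.exp_le_exp.2 e4) e2 (by positivity) (Real.exp_pos _).le
  calc _ = (Real.exp (k * (⟪p, v⟫ - (lse A v + χ v))) * Real.exp (k * S) * Real.exp (-E) * (c * P)) * volume.real U := by
        rw [b3]
        have h1 : ∏ i, (r i - l i) = (1 / 2) ^ n * ∏ i, d i := by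
          have : ((1 : ℝ) / 2) ^ n = ∏ i : Fin n, (1 / 2 : ℝ) := by simp
          rw [this, ← Finset.prod_mul_distrib]
          exact Finset.prod_congr rfl fun i _ => by rw [hrl]; ring
        have h2 : Real.exp (k * S) = ∏ i, Real.exp (k * (|cp i| * (d i / 2))) := by
          rw [← Real.exp_sum, hS, Finset.mul_sum]
        rw [h1, h2, Finset.prod_mul_distrib]
        ring
    _ ≤ ∫ w in U, Real.exp ((k : ℝ) * (⟪p, w⟫ - (lse A w + χ w))) * (Hf A w).det := by
        apply setIntegral_ge_of_const_le_real b1 b2 hlow hLat.integrableOn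
    _ ≤ _ := setIntegral_le_integral hLat (ae_of_all _ fun w => (hpos w).le)

end nlower

end

section
section lattice
variable {n : ℕ}

lemma sum_exp_int (t x : ℝ) (ht : 0 < t) (ht1 : t ≤ 1) (J : Finset ℤ) :
    ∑ j ∈ J, Real.exp (-(t * |(j : ℝ) - x|)) ≤ 4 * Real.exp 1 / t := by
  have hr1 : Real.exp (-t) < 1 := by rw [Real.exp_lt_one_iff]; linarith
  have hr0 : 0 < Real.exp (-t) := Real.exp_pos _
  have hden : t / 2 ≤ 1 - Real.exp (-t) := by
    have h := exp_le_quad (x := -t) (by rw [abs_neg, abs_of_pos ht]; exact ht1)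
    have h3 := Real.abs_exp_sub_one_sub_id_le (x := -t) (by rw [abs_neg, abs_of_pos ht]; exact ht1)
    have h4 : Real.exp (-t) ≤ 1 - t / 2 := by
      have h5 : Real.exp (-t) ≤ 1 / (1 + t) := by
        rw [Real.exp_neg, ← one_div]
        apply one_div_le_one_div_of_le (by linarith)
        linarith [Real.add_one_le_exp t]
      refine h5.trans ?_
      rw [div_le_iff₀ (by linarith)]
      nlinarith
    linarith
  let f : ℤ → ℝ := fun j => Real.exp (-(t * |(j : ℝ)|))
  have hs1 : HasSum (fun m : ℕ => f m) (1 - Real.exp (-t))⁻¹ := by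
    have := hasSum_geometric_of_lt_one hr0.le hr1
    convert this using 2 with m
    simp only [f, Int.cast_natCast, Nat.abs_cast]
    rw [← Real.exp_nat_mul]; congr 1; ring
  have hs2 : HasSum (fun m : ℕ => f (-((m : ℤ) + 1))) (Real.exp (-t) * (1 - Real.exp (-t))⁻¹) := by
    have := (hasSum_geometric_of_lt_one hr0.le hr1).mul_left (Real.exp (-t))
    have e : (fun m : ℕ => f (-((m : ℤ) + 1))) = fun m : ℕ => Real.exp (-t) * Real.exp (-t) ^ m := by
      funext m
      simp only [f]
      rw [← Real.exp_nat_mul, ← Real.exp_add]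
      push_cast
      rw [abs_neg, abs_of_nonneg (by positivity)]
      congr 1; ring
    rw [e]; exact this
  have hs := HasSum.of_nat_of_neg_add_one hs1 hs2
  have hbd : ∀ J : Finset ℤ, ∑ j ∈ J, f j ≤ 4 / t := by
    intro J
    refine (sum_le_hasSum J (fun j _ => (Real.exp_pos _).le) hs).trans ?_
    have hinv : (1 - Real.exp (-t))⁻¹ ≤ 2 / t := by
      rw [inv_le_comm₀ (by linarith) (by positivity), inv_div]; exact hden
    have h0 : 0 < (1 - Real.exp (-t))⁻¹ := inv_pos.2 (by linarith)
    have : Real.exp (-t) * (1 - Real.exp (-t))⁻¹ ≤ (1 - Real.exp (-t))⁻¹ := mul_le_of_le_one_left h0.le hr1.le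
    have e : 4 / t = 2 / t + 2 / t := by ring
    linarith
  have hshift : ∀ j : ℤ, Real.exp (-(t * |(j : ℝ) - x|)) ≤ Real.exp 1 * f (j - ⌊x⌋) := by
    intro j
    simp only [f]
    rw [← Real.exp_add]
    apply Real.exp_le_exp.2
    push_cast
    have h1 : |(j : ℝ) - ⌊x⌋| ≤ |(j : ℝ) - x| + |x - ⌊x⌋| := abs_sub_le _ _ _
    have h2 : |x - ⌊x⌋| ≤ 1 := by
      rw [abs_of_nonneg (by linarith [Int.floor_le x])]; linarith [Int.lt_floor_add_one x]
    have h3 : t * |(j : ℝ) - ⌊x⌋| ≤ t * (|(j : ℝ) - x| + 1) := mul_le_mul_of_nonneg_left (by linarith) ht.le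
    linarith
  calc _ ≤ ∑ j ∈ J, Real.exp 1 * f (j - ⌊x⌋) := Finset.sum_le_sum fun j _ => hshift j
    _ = Real.exp 1 * ∑ j ∈ J.map (Equiv.subRight ⌊x⌋).toEmbedding, f j := by
        rw [Finset.sum_map, Finset.mul_sum]; rfl
    _ ≤ Real.exp 1 * (4 / t) := mul_le_mul_of_nonneg_left (hbd _) (Real.exp_pos _).le
    _ = _ := by ring

lemma exists_denominator (bs : Module.Basis (Fin n) ℝ (EE n)) (hLat : ∀ i j, ∃ m : ℤ, bs i j = (m : ℝ)) :
    ∃ D : ℝ, 1 ≤ D ∧ ∀ q : EE n, (∀ j, ∃ m : ℤ, q j = (m : ℝ)) → ∀ i, ∃ m : ℤ, D * bs.repr q i = (m : ℝ) := by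
  choose Q hQ using hLat
  let Qm : Matrix (Fin n) (Fin n) ℤ := Matrix.of Q
  let Qr : Matrix (Fin n) (Fin n) ℝ := Qm.map (fun z : ℤ => (z : ℝ))
  have hQr : ∀ i j, Qr i j = bs i j := fun i j => (hQ i j).symm
  have hq : ∀ q : EE n, Matrix.vecMul (fun i => bs.repr q i) Qr = fun j => q j := by
    intro q
    funext j
    conv_rhs => rw [← bs.sum_repr q]
    simp only [Matrix.vecMul, dotProduct, hQr, WithLp.ofLp_sum, WithLp.ofLp_smul, Finset.sum_apply,
      Pi.smul_apply, smul_eq_mul]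
  have hdetr : Qr.det = (Qm.det : ℝ) := by
    have := (RingHom.map_det (Int.castRingHom ℝ) Qm)
    simp only [RingHom.mapMatrix_apply] at this
    exact this.symm
  have hdet : Qm.det ≠ 0 := by
    intro h0
    have : Qr.det = 0 := by rw [hdetr, h0]; simp
    obtain ⟨c, hc, hc0⟩ := Matrix.exists_vecMul_eq_zero_iff.2 this
    apply hc
    have h1 := hq (∑ i, c i • bs i)
    have h2 : (fun i => bs.repr (∑ i, c i • bs i) i) = c := by
      funext i; rw [bs.repr_sum_self]
    rw [h2, hc0] at h1
    have h3 : (∑ i, c i • bs i) = 0 := by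
      ext j; exact (congrFun h1 j).symm
    rw [← h2, h3]
    funext i; simp
  refine ⟨|(Qm.det : ℝ)|, ?_, ?_⟩
  · have := Int.one_le_abs hdet
    exact_mod_cast this
  · intro q hqi i
    choose z hz using hqi
    have key : (Qm.det : ℝ) * bs.repr q i = ((Matrix.vecMul z Qm.adjugate i : ℤ) : ℝ) := by
      have h1 := congrArg (fun x => Matrix.vecMul x Qr.adjugate i) (hq q)
      simp only [Matrix.vecMul_vecMul, Matrix.mul_adjugate, Matrix.vecMul_smul, Matrix.vecMul_one, Pi.smul_apply, smul_eq_mul] at h1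
      rw [hdetr] at h1
      rw [h1]
      have h2 : Qr.adjugate = Qm.adjugate.map (fun z : ℤ => (z : ℝ)) := by
        have := (RingHom.map_adjugate (Int.castRingHom ℝ) Qm)
        simp only [RingHom.mapMatrix_apply] at this
        exact this.symm
      rw [h2]
      simp only [Matrix.vecMul, dotProduct, Matrix.map_apply, hz]
      push_cast; rfl
    rcases abs_choice (Qm.det : ℝ) with h | h
    · exact ⟨_, by rw [h]; exact key⟩
    · exact ⟨-(Matrix.vecMul z Qm.adjugate i), by rw [h, neg_mul, key, Int.cast_neg]⟩

lemma lattice_sum (bs : Module.Basis (Fin n) ℝ (EE n)) (hLat : ∀ i j, ∃ m : ℤ, bs i j = (m : ℝ)) :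
    ∃ C > (0 : ℝ), ∀ (k : ℕ), 1 ≤ k → ∀ (Λ : Finset (EE n)),
      (∀ p ∈ Λ, ∀ j, ∃ m : ℤ, p j = (m : ℝ) / (k : ℝ)) → ∀ (m : EE n) (d : Fin n → ℝ),
      (∀ i, 0 < d i) → (∀ i, d i ≤ 1) →
      ∑ p ∈ Λ, ∏ i, Real.exp (-(k * (|bs.repr (p - m) i| * (d i / 2)))) ≤ ∏ i, (C / d i) := by
  obtain ⟨D, hD, hDi⟩ := exists_denominator bs hLat
  have hD0 : 0 < D := by linarith
  refine ⟨8 * D * Real.exp 1, by positivity, fun k hk Λ hΛ m d hd hd1 => ?_⟩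
  have hk0 : (0 : ℝ) < k := by exact_mod_cast hk
  have hz : ∀ p ∈ Λ, ∀ i, ∃ z : ℤ, D * (k * bs.repr p i) = z := by
    intro p hp i
    obtain ⟨z, h⟩ := hDi ((k : ℝ) • p) (by
      intro j
      obtain ⟨m, hm⟩ := hΛ p hp j
      refine ⟨m, ?_⟩
      simp [hm]
      field_simp) i
    refine ⟨z, ?_⟩
    rw [← h]
    simp
  choose! z hz using hz
  have hinj : Set.InjOn z Λ := by
    intro p hp q hq hpq
    apply bs.repr.injective
    ext i
    have h1 := hz p hp i
    have h2 := hz q hq i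
    rw [hpq, ← h2] at h1
    have := mul_left_cancel₀ hD0.ne' h1
    exact mul_left_cancel₀ hk0.ne' this
  let t : Fin n → ℝ := fun i => d i / (2 * D)
  let x : Fin n → ℝ := fun i => D * (k * bs.repr m i)
  classical
  let J : Fin n → Finset ℤ := fun i => Λ.image fun p => z p i
  calc _ = ∑ p ∈ Λ, ∏ i, Real.exp (-(t i * |(z p i : ℝ) - x i|)) := by
        refine Finset.sum_congr rfl fun p hp => Finset.prod_congr rfl fun i _ => ?_
        rw [← hz p hp i]
        simp only [x, t]
        rw [← mul_sub, ← mul_sub, map_sub, Finsupp.sub_apply, abs_mul, abs_mul, abs_of_pos hD0, abs_of_pos hk0]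
        congr 1
        field_simp
    _ = ∑ q ∈ Λ.image z, ∏ i, Real.exp (-(t i * |(q i : ℝ) - x i|)) := by
        rw [Finset.sum_image hinj]
    _ ≤ ∑ q ∈ Fintype.piFinset J, ∏ i, Real.exp (-(t i * |(q i : ℝ) - x i|)) := by
        apply Finset.sum_le_sum_of_subset_of_nonneg
        · intro q hq
          obtain ⟨p, hp, rfl⟩ := Finset.mem_image.1 hq
          rw [Fintype.mem_piFinset]
          exact fun i => Finset.mem_image_of_mem _ hp
        · exact fun q _ _ => Finset.prod_nonneg fun i _ => (Real.exp_pos _).le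
    _ = ∏ i, ∑ j ∈ J i, Real.exp (-(t i * |(j : ℝ) - x i|)) := by
        rw [Finset.prod_univ_sum]
    _ ≤ _ := by
        refine Finset.prod_le_prod (fun i _ => Finset.sum_nonneg fun _ _ => (Real.exp_pos _).le) fun i _ => ?_
        have h0 := hd i
        have h1 := hd1 i
        refine (sum_exp_int (t i) (x i) (by simp only [t]; positivity)
          (by simp only [t]; rw [div_le_one (by positivity)]; linarith) (J i)).trans (le_of_eq ?_)
        simp only [t]
        field_simp
        norm_num

lemma key_bound (A : Finset (EE n)) (hspan : affineSpan ℝ (A : Set (EE n)) = ⊤)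
    (hLat : ∀ α ∈ A, ∀ i, ∃ m : ℤ, α i = (m : ℝ)) (χ : EE n → ℝ)
    (hχ : ContDiff ℝ (⊤ : ℕ∞) χ) (hc : HasCompactSupport χ) (M : ℝ) (hM : ∀ x, |χ x| ≤ M)
    (Λ : ℕ → Finset (EE n))
    (hΛ : ∀ k : ℕ, 1 ≤ k → ((Λ k : Set (EE n))
      = convexHull ℝ (A : Set (EE n)) ∩ {p | ∀ i, ∃ m : ℤ, p i = (m : ℝ) / (k : ℝ)}))
    (N : ℕ → EE n → ℝ)
    (hN : ∀ k p, N k p = ∫ w, Real.exp ((k : ℝ) * (⟪p, w⟫ - (lse A w + χ w))) * (Hf A w).det)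
    (β : EE n) (hβ : β ∈ A)
    (bs : Module.Basis (Fin n) ℝ (EE n)) (hbs : ∀ i, bs i + β ∈ A) :
    ∃ C > (0 : ℝ), ∀ k : ℕ, 1 ≤ k → ∀ v, Good A β bs k v →
      ∑ p ∈ Λ k, Real.exp ((k : ℝ) * (⟪p, v⟫ - (lse A v + χ v))) / N k p ≤ C * (k : ℝ) ^ n := by
  obtain ⟨δ, hδ, c, hc0, hδ1, H⟩ := N_lower A hspan χ hχ hc M hM β hβ bs hbs
  obtain ⟨C, hC, HC⟩ := lattice_sum bs (by
    intro i j
    obtain ⟨m1, h1⟩ := hLat _ (hbs i) j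
    obtain ⟨m2, h2⟩ := hLat _ hβ j
    refine ⟨m1 - m2, ?_⟩
    push_cast
    rw [← h1, ← h2]; simp)
  refine ⟨c⁻¹ * (C / δ ^ 2) ^ n, by positivity, fun k hk v hv => ?_⟩
  have hk0 : (0 : ℝ) < k := by exact_mod_cast hk
  obtain ⟨m, Hm⟩ := H k hk v hv
  obtain ⟨g1, g2, g3⟩ := hv
  have hky : ∀ i, 1 ≤ k * Real.exp ⟪bs i, v⟫ := by
    intro i
    have := Real.exp_le_exp.2 (g2 i)
    rw [Real.exp_neg, Real.exp_log hk0] at this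
    calc (1 : ℝ) = k * (k : ℝ)⁻¹ := by field_simp
      _ ≤ _ := by gcongr
  have hmem : ∀ p ∈ Λ k, p ∈ convexHull ℝ (A : Set (EE n)) ∧ ∀ i, ∃ m : ℤ, p i = (m : ℝ) / (k : ℝ) := by
    intro p hp
    have : p ∈ (Λ k : Set (EE n)) := hp
    rw [hΛ k hk] at this
    exact this
  obtain ⟨d, hd⟩ : ∃ d : Fin n → ℝ, d = fun i => δ / √(k * Real.exp ⟪bs i, v⟫) := ⟨_, rfl⟩
  have hdi : ∀ i, δ / √(k * Real.exp ⟪bs i, v⟫) = d i := fun i => by rw [hd]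
  have hd0 : ∀ i, 0 < d i := fun i => by rw [hd]; positivity
  have hd1 : ∀ i, d i ≤ 1 := fun i => by
    rw [hd]; exact (div_le_self hδ.le (Real.one_le_sqrt.2 (hky i))).trans hδ1
  simp only [hdi] at Hm
  have HL := HC k hk (Λ k) (fun p hp => (hmem p hp).2) m d hd0 hd1
  set P := ∏ i, (Real.exp ⟪bs i, v⟫ * d i) with hP
  have hP0 : 0 < P := Finset.prod_pos fun i _ => mul_pos (Real.exp_pos _) (hd0 i)
  calc _ ≤ ∑ p ∈ Λ k, (c⁻¹ * P⁻¹) * ∏ i, Real.exp (-(k * (|bs.repr (p - m) i| * (d i / 2)))) := by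
        refine Finset.sum_le_sum fun p hp => ?_
        have h1 := Hm p (hmem p hp).1
        rw [← hN] at h1
        have hX : 0 < ∏ i, Real.exp (k * (|bs.repr (p - m) i| * (d i / 2))) :=
          Finset.prod_pos fun _ _ => Real.exp_pos _
        have hE := Real.exp_pos ((k : ℝ) * (⟪p, v⟫ - (lse A v + χ v)))
        have e : ∏ i, Real.exp (-(k * (|bs.repr (p - m) i| * (d i / 2)))) =
            (∏ i, Real.exp (k * (|bs.repr (p - m) i| * (d i / 2))))⁻¹ := by
          rw [← Finset.prod_inv_distrib]
          exact Finset.prod_congr rfl fun i _ => Real.exp_neg _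
        rw [e]
        refine (div_le_div_of_nonneg_left hE.le (by positivity) h1).trans (le_of_eq ?_)
        field_simp
    _ = (c⁻¹ * P⁻¹) * ∑ p ∈ Λ k, ∏ i, Real.exp (-(k * (|bs.repr (p - m) i| * (d i / 2)))) := by
        rw [Finset.mul_sum]
    _ ≤ (c⁻¹ * P⁻¹) * ∏ i, (C / d i) := by gcongr
    _ = c⁻¹ * ∏ i, ((Real.exp ⟪bs i, v⟫ * d i)⁻¹ * (C / d i)) := by
        rw [hP, ← Finset.prod_inv_distrib, mul_assoc, ← Finset.prod_mul_distrib]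
    _ = c⁻¹ * ∏ i : Fin n, (C / δ ^ 2 * k) := by
        congr 1
        refine Finset.prod_congr rfl fun i _ => ?_
        have h1 : d i ^ 2 = δ ^ 2 / (k * Real.exp ⟪bs i, v⟫) := by
          rw [hd]; simp only; rw [div_pow, Real.sq_sqrt (by positivity)]
        have h2 : (Real.exp ⟪bs i, v⟫ * d i)⁻¹ * (C / d i) = C / (Real.exp ⟪bs i, v⟫ * d i ^ 2) := by
          have := hd0 i
          field_simp
        rw [h2, h1]
        field_simp
    _ = _ := by
        simp only [Finset.prod_const, Finset.card_univ, Fintype.card_fin]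
        rw [mul_pow]; ring

end lattice

end

section
section reduction
variable {n : ℕ}

lemma eq_zero_of_span (T : Set (EE n)) (hT : Submodule.span ℝ T = ⊤) (d : EE n)
    (h : ∀ x ∈ T, ⟪x, d⟫ = 0) : d = 0 := by
  have : ∀ x ∈ Submodule.span ℝ T, ⟪x, d⟫ = 0 := by
    intro x hx
    induction hx using Submodule.span_induction with
    | mem x hx => exact h x hx
    | zero => simp
    | add x y _ _ h1 h2 => rw [inner_add_left, h1, h2, add_zero]
    | smul a x _ h1 => rw [real_inner_smul_left, h1, mul_zero]
  have h2 := this d (by rw [hT]; trivial)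
  exact inner_self_eq_zero.1 h2

lemma exists_orth_of_not_span (T : Set (EE n)) (hT : Submodule.span ℝ T ≠ ⊤) :
    ∃ d : EE n, d ≠ 0 ∧ ∀ x ∈ T, ⟪x, d⟫ = 0 := by
  have : (Submodule.span ℝ T)ᗮ ≠ ⊥ := by
    intro h; exact hT ((Submodule.orthogonal_eq_bot_iff).1 h)
  obtain ⟨d, hd, hd0⟩ := Submodule.exists_mem_ne_zero_of_ne_bot this
  exact ⟨d, hd0, fun x hx => (Submodule.mem_orthogonal _ _).1 hd x (Submodule.subset_span hx)⟩

/-- Kernel sum relative to a vertex. -/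
noncomputable def Kt (Λ : Finset (EE n)) (a : EE n → ℝ) (k : ℝ) (β v : EE n) : ℝ :=
  ∑ p ∈ Λ, a p * Real.exp (k * ⟪p - β, v⟫)

lemma Kt_move (Λ : Finset (EE n)) (a : EE n → ℝ) (ha : ∀ p ∈ Λ, 0 ≤ a p) (k : ℝ) (hk : 0 ≤ k)
    (β w d : EE n) (hD : 0 ≤ ∑ p ∈ Λ, a p * Real.exp (k * ⟪p - β, w⟫) * ⟪p - β, d⟫) (s : ℝ) (hs : 0 ≤ s) :
    Kt Λ a k β w ≤ Kt Λ a k β (w + s • d) := by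
  unfold Kt
  have h1 : ∀ p ∈ Λ, a p * Real.exp (k * ⟪p - β, w⟫) + k * s * (a p * Real.exp (k * ⟪p - β, w⟫) * ⟪p - β, d⟫)
      ≤ a p * Real.exp (k * ⟪p - β, w + s • d⟫) := by
    intro p hp
    rw [inner_add_right, inner_smul_right, mul_add, Real.exp_add]
    have h2 := Real.add_one_le_exp (k * (s * ⟪p - β, d⟫))
    have h3 : 0 ≤ a p * Real.exp (k * ⟪p - β, w⟫) := mul_nonneg (ha p hp) (Real.exp_pos _).le
    have := mul_le_mul_of_nonneg_left h2 h3
    linarith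
  have h4 := Finset.sum_le_sum h1
  rw [Finset.sum_add_distrib, ← Finset.mul_sum] at h4
  have : 0 ≤ k * s * ∑ p ∈ Λ, a p * Real.exp (k * ⟪p - β, w⟫) * ⟪p - β, d⟫ := by positivity
  linarith

lemma move_step (A : Finset (EE n)) (hspan : affineSpan ℝ (A : Set (EE n)) = ⊤) (β : EE n) (hβ : β ∈ A)
    (Mx : EE n → ℝ) (Λ : Finset (EE n)) (hΛ : ∀ p ∈ Λ, p ∈ convexHull ℝ (A : Set (EE n)))
    (a : EE n → ℝ) (ha : ∀ p ∈ Λ, 0 ≤ a p) (k : ℝ) (hk : 0 ≤ k) (w : EE n)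
    (hw : ∀ α ∈ A, ⟪α - β, w⟫ ≤ Mx α)
    (hns : Submodule.span ℝ {x : EE n | ∃ α ∈ A, ⟪α - β, w⟫ = Mx α ∧ x = α - β} ≠ ⊤) :
    ∃ w', (∀ α ∈ A, ⟪α - β, w'⟫ ≤ Mx α) ∧ (∀ α ∈ A, ⟪α - β, w⟫ = Mx α → ⟪α - β, w'⟫ = Mx α) ∧
      (∃ α ∈ A, ⟪α - β, w⟫ ≠ Mx α ∧ ⟪α - β, w'⟫ = Mx α) ∧ Kt Λ a k β w ≤ Kt Λ a k β w' := by
  obtain ⟨d₀, hd₀, ho₀⟩ := exists_orth_of_not_span _ hns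
  have hhull : ∀ d : EE n, (∀ α ∈ A, ⟪α - β, d⟫ ≤ 0) → ∀ p ∈ Λ, ⟪p - β, d⟫ ≤ 0 := by
    intro d h p hp
    have := inner_le_of_hull A (hΛ p hp) d ⟪β, d⟫ (fun α hα => by
      have := h α hα; rw [inner_sub_left] at this; linarith)
    rw [inner_sub_left]; linarith
  set D : EE n → ℝ := fun d => ∑ p ∈ Λ, a p * Real.exp (k * ⟪p - β, w⟫) * ⟪p - β, d⟫ with hD
  have hDneg : ∀ d, D (-d) = -D d := by
    intro d; simp only [hD, inner_neg_right, mul_neg, Finset.sum_neg_distrib]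
  have hDnp : ∀ d : EE n, (∀ α ∈ A, ⟪α - β, d⟫ ≤ 0) → D d ≤ 0 := by
    intro d h
    apply Finset.sum_nonpos
    intro p hp
    exact mul_nonpos_of_nonneg_of_nonpos (mul_nonneg (ha p hp) (Real.exp_pos _).le) (hhull d h p hp)
  obtain ⟨d, hdo, hdD, α₀, hα₀, hhit⟩ : ∃ d : EE n, (∀ α ∈ A, ⟪α - β, w⟫ = Mx α → ⟪α - β, d⟫ = 0) ∧
      0 ≤ D d ∧ ∃ α ∈ A, 0 < ⟪α - β, d⟫ := by
    have ho1 : ∀ α ∈ A, ⟪α - β, w⟫ = Mx α → ⟪α - β, d₀⟫ = 0 := fun α hα h => ho₀ _ ⟨α, hα, h, rfl⟩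
    have ho2 : ∀ α ∈ A, ⟪α - β, w⟫ = Mx α → ⟪α - β, -d₀⟫ = 0 := fun α hα h => by
      rw [inner_neg_right, ho1 α hα h, neg_zero]
    by_cases h1 : ∃ α ∈ A, 0 < ⟪α - β, d₀⟫
    · by_cases h2 : ∃ α ∈ A, 0 < ⟪α - β, -d₀⟫
      · rcases le_total 0 (D d₀) with h | h
        · exact ⟨d₀, ho1, h, h1⟩
        · exact ⟨-d₀, ho2, by rw [hDneg]; linarith, h2⟩
      · push Not at h2
        have := hDnp _ h2
        rw [hDneg] at this
        exact ⟨d₀, ho1, by linarith, h1⟩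
    · push Not at h1
      by_cases h2 : ∃ α ∈ A, 0 < ⟪α - β, -d₀⟫
      · have := hDnp _ h1
        exact ⟨-d₀, ho2, by rw [hDneg]; linarith, h2⟩
      · push Not at h2
        exfalso
        apply hd₀
        apply eq_zero_of_span _ (span_diff A hspan β hβ)
        rintro _ ⟨α, hα, rfl⟩
        have e1 := h1 α hα
        have e2 := h2 α hα
        rw [inner_neg_right] at e2
        simp only
        linarith
  classical
  obtain ⟨α₁, hα₁, hmin⟩ := (A.filter fun α => 0 < ⟪α - β, d⟫).exists_min_image
    (fun α => (Mx α - ⟪α - β, w⟫) / ⟪α - β, d⟫) ⟨α₀, Finset.mem_filter.2 ⟨hα₀, hhit⟩⟩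
  obtain ⟨hα₁A, hα₁d⟩ := Finset.mem_filter.1 hα₁
  set s := (Mx α₁ - ⟪α₁ - β, w⟫) / ⟪α₁ - β, d⟫ with hs
  have hs0 : 0 ≤ s := div_nonneg (by linarith [hw α₁ hα₁A]) hα₁d.le
  refine ⟨w + s • d, ?_, ?_, ⟨α₁, hα₁A, ?_, ?_⟩, Kt_move Λ a ha k hk β w d hdD s hs0⟩
  · intro α hα
    rw [inner_add_right, inner_smul_right]
    rcases lt_or_ge 0 ⟪α - β, d⟫ with h | h
    · have := hmin α (Finset.mem_filter.2 ⟨hα, h⟩)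
      rw [le_div_iff₀ h] at this
      linarith
    · have := mul_nonpos_of_nonneg_of_nonpos hs0 h
      linarith [hw α hα]
  · intro α hα h
    rw [inner_add_right, inner_smul_right, hdo α hα h, mul_zero, add_zero, h]
  · intro h
    have := hdo α₁ hα₁A h
    linarith
  · rw [inner_add_right, inner_smul_right, hs, div_mul_cancel₀ _ hα₁d.ne']
    ring

lemma move_all (A : Finset (EE n)) (hspan : affineSpan ℝ (A : Set (EE n)) = ⊤) (β : EE n) (hβ : β ∈ A)
    (Mx : EE n → ℝ) (Λ : Finset (EE n)) (hΛ : ∀ p ∈ Λ, p ∈ convexHull ℝ (A : Set (EE n)))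
    (a : EE n → ℝ) (ha : ∀ p ∈ Λ, 0 ≤ a p) (k : ℝ) (hk : 0 ≤ k) (m : ℕ) : ∀ (w : EE n)
    (_ : ∀ α ∈ A, ⟪α - β, w⟫ ≤ Mx α) (_ : {α ∈ A | ⟪α - β, w⟫ ≠ Mx α}.card ≤ m),
    ∃ w', (∀ α ∈ A, ⟪α - β, w'⟫ ≤ Mx α) ∧ (∀ α ∈ A, ⟪α - β, w⟫ = Mx α → ⟪α - β, w'⟫ = Mx α) ∧
      Submodule.span ℝ {x : EE n | ∃ α ∈ A, ⟪α - β, w'⟫ = Mx α ∧ x = α - β} = ⊤ ∧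
      Kt Λ a k β w ≤ Kt Λ a k β w' := by
  induction m with
  | zero =>
    intro w hw hcard
    refine ⟨w, hw, fun _ _ h => h, ?_, le_rfl⟩
    by_contra hns
    obtain ⟨w', _, _, ⟨α, hα, h1, _⟩, _⟩ := move_step A hspan β hβ Mx Λ hΛ a ha k hk w hw hns
    have : α ∈ ({α ∈ A | ⟪α - β, w⟫ ≠ Mx α} : Finset (EE n)) := Finset.mem_filter.2 ⟨hα, h1⟩
    rw [Finset.card_eq_zero.1 (Nat.le_zero.1 hcard)] at this
    simp at this
  | succ m ih =>
    intro w hw hcard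
    by_cases hns : Submodule.span ℝ {x : EE n | ∃ α ∈ A, ⟪α - β, w⟫ = Mx α ∧ x = α - β} = ⊤
    · exact ⟨w, hw, fun _ _ h => h, hns, le_rfl⟩
    obtain ⟨w1, h1, h2, ⟨α, hα, h3, h4⟩, h5⟩ := move_step A hspan β hβ Mx Λ hΛ a ha k hk w hw hns
    have hlt : {α ∈ A | ⟪α - β, w1⟫ ≠ Mx α}.card < {α ∈ A | ⟪α - β, w⟫ ≠ Mx α}.card := by
      apply Finset.card_lt_card
      rw [Finset.ssubset_iff_of_subset]
      · exact ⟨α, Finset.mem_filter.2 ⟨hα, h3⟩, fun h => (Finset.mem_filter.1 h).2 h4⟩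
      · intro γ hγ
        obtain ⟨g1, g2⟩ := Finset.mem_filter.1 hγ
        exact Finset.mem_filter.2 ⟨g1, fun h => g2 (h2 γ g1 h)⟩
    obtain ⟨w', g1, g2, g3, g4⟩ := ih w1 h1 (by omega)
    exact ⟨w', g1, fun α hα h => g2 α hα (h2 α hα h), g3, h5.trans g4⟩

end reduction

end

section
section uniform
variable {n : ℕ}

lemma exists_good_basis (A : Finset (EE n)) (β v : EE n) (k : ℕ)
    (hmax : ∀ α ∈ A, ⟪α - β, v⟫ ≤ 0)
    (hT : Submodule.span ℝ {x : EE n | ∃ α ∈ A, -Real.log k ≤ ⟪α - β, v⟫ ∧ x = α - β} = ⊤) :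
    ∃ (b : Fin n → A) (h : LinearIndependent ℝ fun i => (b i : EE n) - β),
      Good A β (basisOfLinearIndependentOfCardEqFinrank' _ h (by simp)) k v := by
  classical
  obtain ⟨b0, hb0, hli0⟩ := exists_basis_of_span _ hT
  choose f hfA hf1 hf2 using hb0
  let F : Finset (Fin n → A) := Finset.univ.filter fun b => LinearIndependent ℝ fun i => (b i : EE n) - β
  have hne : F.Nonempty := ⟨fun i => ⟨f i, hfA i⟩, Finset.mem_filter.2 ⟨Finset.mem_univ _, by
    have : (fun i => f i - β) = b0 := funext fun i => (hf2 i).symm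
    simp only
    rw [this]; exact hli0⟩⟩
  obtain ⟨b, hbF, hbmax⟩ := F.exists_max_image (fun b => ∑ i, ⟪(b i : EE n), v⟫) hne
  have h := (Finset.mem_filter.1 hbF).2
  refine ⟨b, h, hmax, ?_⟩
  set bs := basisOfLinearIndependentOfCardEqFinrank' (fun i => (b i : EE n) - β) h (by simp) with hbs
  have hbsi : ∀ i, bs i = (b i : EE n) - β := fun i => by
    rw [hbs, coe_basisOfLinearIndependentOfCardEqFinrank']
  have h3 : ∀ α ∈ A, ∀ i, bs.repr (α - β) i ≠ 0 → ⟪α - β, v⟫ ≤ ⟪bs i, v⟫ := by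
    intro α hα i hi
    let b' : Fin n → A := Function.update b i ⟨α, hα⟩
    have e : (fun j => (b' j : EE n) - β) = Function.update (⇑bs) i (α - β) := by
      funext j
      by_cases hj : j = i
      · subst hj; simp [b']
      · simp [b', hj, hbsi]
    have hli : LinearIndependent ℝ fun j => (b' j : EE n) - β := by
      rw [e]
      exact bs.linearIndependent.update i _ ⟨1, one_mem _, bs.repr (α - β),
        mem_nonZeroDivisors_of_ne_zero hi, by rw [one_smul, bs.linearCombination_repr]⟩
    have := hbmax b' (Finset.mem_filter.2 ⟨Finset.mem_univ _, hli⟩)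
    rw [← Finset.add_sum_erase _ _ (Finset.mem_univ i), ← Finset.add_sum_erase _ _ (Finset.mem_univ i)] at this
    have e2 : ∑ j ∈ Finset.univ.erase i, ⟪(b' j : EE n), v⟫ = ∑ j ∈ Finset.univ.erase i, ⟪(b j : EE n), v⟫ := by
      refine Finset.sum_congr rfl fun j hj => ?_
      simp [b', Finset.ne_of_mem_erase hj]
    rw [e2] at this
    have e3 : (b' i : EE n) = α := by simp [b']
    rw [e3] at this
    rw [hbsi, inner_sub_left, inner_sub_left]
    linarith
  refine ⟨fun i => ?_, h3⟩
  by_contra hlt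
  push Not at hlt
  have hz : ∀ x ∈ Submodule.span ℝ {x : EE n | ∃ α ∈ A, -Real.log k ≤ ⟪α - β, v⟫ ∧ x = α - β}, bs.repr x i = 0 := by
    intro x hx
    induction hx using Submodule.span_induction with
    | mem x hx =>
      obtain ⟨α, hα, h1, rfl⟩ := hx
      by_contra h0
      have := h3 α hα i h0
      linarith
    | zero => simp
    | add x y _ _ h1 h2 => rw [map_add, Finsupp.add_apply, h1, h2, add_zero]
    | smul a x _ h1 => rw [map_smul, Finsupp.smul_apply, h1, smul_zero]
  have := hz (bs i) (by rw [hT]; trivial)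
  simp at this

lemma uniform_bound (A : Finset (EE n)) (hspan : affineSpan ℝ (A : Set (EE n)) = ⊤)
    (hLat : ∀ α ∈ A, ∀ i, ∃ m : ℤ, α i = (m : ℝ)) (χ : EE n → ℝ)
    (hχ : ContDiff ℝ (⊤ : ℕ∞) χ) (hc : HasCompactSupport χ) (M : ℝ) (hM : ∀ x, |χ x| ≤ M)
    (Λ : ℕ → Finset (EE n))
    (hΛ : ∀ k : ℕ, 1 ≤ k → ((Λ k : Set (EE n))
      = convexHull ℝ (A : Set (EE n)) ∩ {p | ∀ i, ∃ m : ℤ, p i = (m : ℝ) / (k : ℝ)}))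
    (N : ℕ → EE n → ℝ)
    (hN : ∀ k p, N k p = ∫ w, Real.exp ((k : ℝ) * (⟪p, w⟫ - (lse A w + χ w))) * (Hf A w).det) :
    ∃ C > (0 : ℝ), ∀ k : ℕ, 1 ≤ k → ∀ β ∈ A, ∀ v, (∀ α ∈ A, ⟪α - β, v⟫ ≤ 0) →
      Submodule.span ℝ {x : EE n | ∃ α ∈ A, -Real.log k ≤ ⟪α - β, v⟫ ∧ x = α - β} = ⊤ →
      ∑ p ∈ Λ k, Real.exp ((k : ℝ) * (⟪p, v⟫ - (lse A v + χ v))) / N k p ≤ C * (k : ℝ) ^ n := by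
  have h1 : ∀ (β : A) (b : Fin n → A), ∃ C > (0 : ℝ),
      ∀ h : LinearIndependent ℝ fun i => (b i : EE n) - (β : EE n), ∀ k : ℕ, 1 ≤ k → ∀ v,
        Good A β (basisOfLinearIndependentOfCardEqFinrank' _ h (by simp)) k v →
        ∑ p ∈ Λ k, Real.exp ((k : ℝ) * (⟪p, v⟫ - (lse A v + χ v))) / N k p ≤ C * (k : ℝ) ^ n := by
    intro β b
    by_cases h : LinearIndependent ℝ fun i => (b i : EE n) - (β : EE n)
    · obtain ⟨C, hC, H⟩ := key_bound A hspan hLat χ hχ hc M hM Λ hΛ N hN β β.2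
        (basisOfLinearIndependentOfCardEqFinrank' _ h (by simp))
        (fun i => by rw [coe_basisOfLinearIndependentOfCardEqFinrank']; simp)
      exact ⟨C, hC, fun _ => H⟩
    · exact ⟨1, one_pos, fun h' => absurd h' h⟩
  choose C hC H using h1
  have hA := nonempty_of_span A hspan
  have hle : ∀ β b, C β b ≤ ∑ β, ∑ b, C β b := by
    intro β b
    refine le_trans ?_ (Finset.single_le_sum (f := fun β => ∑ b, C β b)
      (fun β _ => Finset.sum_nonneg fun b _ => (hC β b).le) (Finset.mem_univ β))
    exact Finset.single_le_sum (f := fun b => C β b) (fun b _ => (hC β b).le) (Finset.mem_univ b)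
  refine ⟨∑ β, ∑ b, C β b, ?_, ?_⟩
  · obtain ⟨β, hβ⟩ := hA
    exact lt_of_lt_of_le (hC ⟨β, hβ⟩ fun _ => ⟨β, hβ⟩) (hle _ _)
  · intro k hk β hβ v h2 h3
    obtain ⟨b, hb, hg⟩ := exists_good_basis A β v k h2 h3
    refine (H ⟨β, hβ⟩ b hb k hk v hg).trans ?_
    have := hle ⟨β, hβ⟩ b
    gcongr

end uniform

end

section
section final_a
variable {n : ℕ}

lemma lse_sub (A : Finset (EE n)) (hA : A.Nonempty) (β v : EE n) :
    lse A v - ⟪β, v⟫ = Real.log (∑ α ∈ A, Real.exp ⟪α - β, v⟫) := by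
  have h : (∑ α ∈ A, Real.exp ⟪α - β, v⟫) = Zf A v * Real.exp (-⟪β, v⟫) := by
    unfold Zf
    rw [Finset.sum_mul]
    refine Finset.sum_congr rfl fun α _ => ?_
    rw [← Real.exp_add, inner_sub_left]; congr 1
  rw [h, Real.log_mul (Zf_pos hA v).ne' (Real.exp_pos _).ne', Real.log_exp]
  rfl

lemma lse_compare (A : Finset (EE n)) (β : EE n) (hβ : β ∈ A) (v v' : EE n) (k : ℕ)
    (hk : 1 ≤ k) (h : ∀ α ∈ A, ⟪α - β, v'⟫ ≤ max ⟪α - β, v⟫ (-Real.log k)) :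
    k * (lse A v' - ⟪β, v'⟫) ≤ k * (lse A v - ⟪β, v⟫) + A.card := by
  have hA : A.Nonempty := ⟨β, hβ⟩
  have hk0 : (0 : ℝ) < k := by exact_mod_cast hk
  rw [lse_sub A hA, lse_sub A hA]
  set W := ∑ α ∈ A, Real.exp ⟪α - β, v⟫ with hW
  set W' := ∑ α ∈ A, Real.exp ⟪α - β, v'⟫ with hW'
  have hWp : 0 < W := Finset.sum_pos (fun _ _ => Real.exp_pos _) hA
  have hWp' : 0 < W' := Finset.sum_pos (fun _ _ => Real.exp_pos _) hA
  have hW1 : 1 ≤ W := by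
    have := Finset.single_le_sum (f := fun α => Real.exp ⟪α - β, v⟫) (fun _ _ => (Real.exp_pos _).le) hβ
    simp only [sub_self, inner_zero_left, Real.exp_zero] at this
    exact this
  have hWW : W' ≤ W + A.card / k := by
    calc W' ≤ ∑ α ∈ A, (Real.exp ⟪α - β, v⟫ + 1 / k) := by
          refine Finset.sum_le_sum fun α hα => ?_
          have h1 := h α hα
          rcases le_max_iff.1 h1 with h2 | h2
          · have := Real.exp_le_exp.2 h2
            have : (0 : ℝ) ≤ 1 / k := by positivity
            linarith
          · have h3 := Real.exp_le_exp.2 h2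
            rw [Real.exp_neg, Real.exp_log hk0] at h3
            have := Real.exp_pos ⟪α - β, v⟫
            rw [one_div]; linarith
      _ = _ := by rw [Finset.sum_add_distrib, Finset.sum_const, nsmul_eq_mul]; ring
  have hlog : Real.log W' ≤ Real.log W + A.card / k := by
    have h1 := Real.log_le_sub_one_of_pos (x := W' / W) (by positivity)
    rw [Real.log_div hWp'.ne' hWp.ne'] at h1
    have h2 : W' / W ≤ 1 + A.card / k := by
      rw [div_le_iff₀ hWp]
      have : (0 : ℝ) ≤ A.card / k := by positivity
      nlinarith
    linarith
  have := mul_le_mul_of_nonneg_left hlog hk0.le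
  have e : k * (Real.log W + A.card / k) = k * Real.log W + A.card := by field_simp
  linarith

lemma bound_large (A : Finset (EE n)) (hspan : affineSpan ℝ (A : Set (EE n)) = ⊤)
    (hLat : ∀ α ∈ A, ∀ i, ∃ m : ℤ, α i = (m : ℝ)) (χ : EE n → ℝ)
    (hχ : ContDiff ℝ (⊤ : ℕ∞) χ) (hc : HasCompactSupport χ) (M : ℝ) (hM : ∀ x, |χ x| ≤ M)
    (Λ : ℕ → Finset (EE n))
    (hΛ : ∀ k : ℕ, 1 ≤ k → ((Λ k : Set (EE n))
      = convexHull ℝ (A : Set (EE n)) ∩ {p | ∀ i, ∃ m : ℤ, p i = (m : ℝ) / (k : ℝ)}))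
    (N : ℕ → EE n → ℝ)
    (hN : ∀ k p, N k p = ∫ w, Real.exp ((k : ℝ) * (⟪p, w⟫ - (lse A w + χ w))) * (Hf A w).det) :
    ∃ C > (0 : ℝ), ∃ k₀ : ℕ, ∀ k : ℕ, 1 ≤ k → k₀ ≤ k → ∀ v,
      ∑ p ∈ Λ k, Real.exp ((k : ℝ) * (⟪p, v⟫ - (lse A v + χ v))) / N k p ≤ C * (k : ℝ) ^ n := by
  have hA := nonempty_of_span A hspan
  obtain ⟨C, hC, H⟩ := uniform_bound A hspan hLat χ hχ hc M hM Λ hΛ N hN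
  obtain ⟨R0, hR0⟩ := hc.isCompact.isBounded.exists_norm_le
  set Q : ℝ := (∑ α ∈ A, ∑ β ∈ A, ‖α - β‖) * |R0| with hQ
  have hQb : ∀ α ∈ A, ∀ β ∈ A, ∀ w ∈ tsupport χ, -Q ≤ ⟪α - β, w⟫ := by
    intro α hα β hβ w hw
    have h1 := (abs_le.1 (abs_real_inner_le_norm (α - β) w)).1
    have h2 : ‖α - β‖ ≤ ∑ α ∈ A, ∑ β ∈ A, ‖α - β‖ := by
      refine le_trans ?_ (Finset.single_le_sum (f := fun α => ∑ β ∈ A, ‖α - β‖)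
        (fun _ _ => Finset.sum_nonneg fun _ _ => norm_nonneg _) hα)
      exact Finset.single_le_sum (f := fun β => ‖α - β‖) (fun _ _ => norm_nonneg _) hβ
    have h3 : ‖α - β‖ * ‖w‖ ≤ Q :=
      mul_le_mul h2 ((hR0 w hw).trans (le_abs_self _)) (norm_nonneg _) ((norm_nonneg _).trans h2)
    linarith
  obtain ⟨k₀, hk₀⟩ := exists_nat_gt (Real.exp Q)
  refine ⟨C * Real.exp A.card, by positivity, k₀, fun k hk hkk v => ?_⟩
  have hk0 : (0 : ℝ) < k := by exact_mod_cast hk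
  have hlogk : Q < Real.log k := by
    rw [Real.lt_log_iff_exp_lt hk0]
    exact lt_of_lt_of_le hk₀ (by exact_mod_cast hkk)
  have hlog0 : 0 ≤ Real.log k := Real.log_nonneg (by exact_mod_cast hk)
  have hmem : ∀ p ∈ Λ k, p ∈ convexHull ℝ (A : Set (EE n)) := by
    intro p hp
    have : p ∈ (Λ k : Set (EE n)) := hp
    rw [hΛ k hk] at this
    exact this.1
  obtain ⟨β, hβ, hmax⟩ := A.exists_max_image (fun α => ⟪α, v⟫) hA
  set Mx : EE n → ℝ := fun α => max ⟪α - β, v⟫ (-Real.log k) with hMx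
  have hNn : ∀ p ∈ Λ k, 0 ≤ (N k p)⁻¹ := by
    intro p hp
    rw [hN]
    exact inv_nonneg.2 (Nterm_pos A hspan χ hχ.continuous M hM k (hmem p hp)).le
  obtain ⟨v', h1, h2, h3, h4⟩ := move_all A hspan β hβ Mx (Λ k) hmem (fun p => (N k p)⁻¹) hNn k hk0.le _ v
    (fun α _ => le_max_left _ _) le_rfl
  have hKt : ∀ w, ∑ p ∈ Λ k, Real.exp ((k : ℝ) * (⟪p, w⟫ - (lse A w + χ w))) / N k p =
      Kt (Λ k) (fun p => (N k p)⁻¹) k β w * Real.exp (-(k * (lse A w - ⟪β, w⟫ + χ w))) := by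
    intro w
    unfold Kt
    rw [Finset.sum_mul]
    refine Finset.sum_congr rfl fun p _ => ?_
    rw [mul_assoc, ← Real.exp_add, div_eq_inv_mul, inner_sub_left]
    congr 2
    ring
  have hχv : χ v' = χ v := by
    have heq : v' = v → χ v' = χ v := fun h => by rw [h]
    by_cases hv : v ∈ tsupport χ
    · apply heq
      rw [← sub_eq_zero]
      apply eq_zero_of_span _ (span_diff A hspan β hβ)
      rintro _ ⟨α, hα, rfl⟩
      have e1 : Mx α = ⟪α - β, v⟫ := max_eq_left (by have := hQb α hα β hβ v hv; linarith)
      have e2 := h2 α hα e1.symm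
      simp only
      rw [inner_sub_right, e2, e1, sub_self]
    · by_cases hv' : v' ∈ tsupport χ
      · apply heq
        rw [← sub_eq_zero]
        apply eq_zero_of_span _ h3
        rintro _ ⟨α, hα, ht, rfl⟩
        have e1 := hQb α hα β hβ v' hv'
        have e2 : Mx α = ⟪α - β, v⟫ := by
          rcases max_choice ⟪α - β, v⟫ (-Real.log k) with h | h
          · exact h
          · exfalso
            have : Mx α = -Real.log k := h
            linarith
        rw [inner_sub_right, ht, e2, sub_self]
      · rw [image_eq_zero_of_notMem_tsupport hv, image_eq_zero_of_notMem_tsupport hv']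
  have hB' := H k hk β hβ v' (fun α hα => (h1 α hα).trans (max_le
      (by have := hmax α hα; rw [inner_sub_left]; linarith) (by linarith))) (by
    rw [eq_top_iff, ← h3]
    apply Submodule.span_mono
    rintro _ ⟨α, hα, ht, rfl⟩
    exact ⟨α, hα, by rw [ht]; exact le_max_right _ _, rfl⟩)
  have hcmp := lse_compare A β hβ v v' k hk h1
  rw [hKt v'] at hB'
  rw [hKt v]
  have hKnn : 0 ≤ Kt (Λ k) (fun p => (N k p)⁻¹) k β v' :=
    Finset.sum_nonneg fun p hp => mul_nonneg (hNn p hp) (Real.exp_pos _).le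
  calc _ ≤ Kt (Λ k) (fun p => (N k p)⁻¹) k β v' *
        (Real.exp (-(k * (lse A v' - ⟪β, v'⟫ + χ v'))) * Real.exp A.card) := by
        refine mul_le_mul h4 ?_ (Real.exp_pos _).le hKnn
        rw [← Real.exp_add]
        apply Real.exp_le_exp.2
        rw [hχv]
        linarith
    _ = (Kt (Λ k) (fun p => (N k p)⁻¹) k β v' *
        Real.exp (-(k * (lse A v' - ⟪β, v'⟫ + χ v')))) * Real.exp A.card := by ring
    _ ≤ (C * k ^ n) * Real.exp A.card := by gcongr
    _ = _ := by ring

lemma bound_all (A : Finset (EE n)) (hspan : affineSpan ℝ (A : Set (EE n)) = ⊤)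
    (hLat : ∀ α ∈ A, ∀ i, ∃ m : ℤ, α i = (m : ℝ)) (χ : EE n → ℝ)
    (hχ : ContDiff ℝ (⊤ : ℕ∞) χ) (hc : HasCompactSupport χ) (M : ℝ) (hM : ∀ x, |χ x| ≤ M)
    (Λ : ℕ → Finset (EE n))
    (hΛ : ∀ k : ℕ, 1 ≤ k → ((Λ k : Set (EE n))
      = convexHull ℝ (A : Set (EE n)) ∩ {p | ∀ i, ∃ m : ℤ, p i = (m : ℝ) / (k : ℝ)}))
    (N : ℕ → EE n → ℝ)
    (hN : ∀ k p, N k p = ∫ w, Real.exp ((k : ℝ) * (⟪p, w⟫ - (lse A w + χ w))) * (Hf A w).det) :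
    ∃ C > (0 : ℝ), ∀ k : ℕ, 1 ≤ k → ∀ v,
      ∑ p ∈ Λ k, Real.exp ((k : ℝ) * (⟪p, v⟫ - (lse A v + χ v))) / N k p ≤ C * (k : ℝ) ^ n := by
  obtain ⟨C, hC, k₀, H⟩ := bound_large A hspan hLat χ hχ hc M hM Λ hΛ N hN
  obtain ⟨c, hcd⟩ : ∃ c : ℕ → ℝ, c = fun k => |∑ p ∈ Λ k, Real.exp (k * M) / N k p| := ⟨_, rfl⟩
  have hc0 : ∀ k, 0 ≤ c k := by intro k; rw [hcd]; exact abs_nonneg _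
  have hck : ∀ k, ∑ p ∈ Λ k, Real.exp (k * M) / N k p ≤ c k := by
    intro k; rw [hcd]; exact le_abs_self _
  clear hcd
  obtain ⟨s, hsd⟩ : ∃ s : ℝ, s = ∑ k ∈ Finset.range k₀, c k := ⟨_, rfl⟩
  have hs : 0 ≤ s := by rw [hsd]; exact Finset.sum_nonneg fun k _ => hc0 k
  have hCs : 0 < C + s := by linarith
  refine ⟨C + s, hCs, fun k hk v => ?_⟩
  have hk1 : (1 : ℝ) ≤ k := by exact_mod_cast hk
  have hkn : (1 : ℝ) ≤ (k : ℝ) ^ n := one_le_pow₀ hk1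
  rcases le_or_gt k₀ k with h | h
  · refine (H k hk h v).trans ?_
    exact mul_le_mul_of_nonneg_right (by linarith) (by linarith)
  · have hmem : ∀ p ∈ Λ k, p ∈ convexHull ℝ (A : Set (EE n)) := by
      intro p hp
      have : p ∈ (Λ k : Set (EE n)) := hp
      rw [hΛ k hk] at this
      exact this.1
    have h1 : ∑ p ∈ Λ k, Real.exp ((k : ℝ) * (⟪p, v⟫ - (lse A v + χ v))) / N k p ≤
        ∑ p ∈ Λ k, Real.exp (k * M) / N k p := by
      refine Finset.sum_le_sum fun p hp => ?_
      have hNp : 0 < N k p := by rw [hN]; exact Nterm_pos A hspan χ hχ.continuous M hM k (hmem p hp)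
      have e1 := inner_le_of_hull A (hmem p hp) v _ (fun α hα => inner_le_lse A hα v)
      have e2 := (abs_le.1 (hM v)).1
      have e3 : ⟪p, v⟫ - (lse A v + χ v) ≤ M := by linarith
      gcongr
    have h2 : c k ≤ s := by
      rw [hsd]
      exact Finset.single_le_sum (f := c) (fun k _ => hc0 k) (Finset.mem_range.2 h)
    have h4 : C + s ≤ (C + s) * (k : ℝ) ^ n := le_mul_of_one_le_right hCs.le hkn
    have h5 : s ≤ C + s := by linarith
    exact h1.trans ((hck k).trans (h2.trans (h5.trans h4)))

/-- log-sum-exp convexity -/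
lemma convexOn_log_sum (Λ : Finset (EE n)) (hne : Λ.Nonempty) (a : EE n → ℝ) (ha : ∀ p ∈ Λ, 0 < a p) (k : ℝ) :
    ConvexOn ℝ Set.univ fun v : EE n => Real.log (∑ p ∈ Λ, a p * Real.exp (k * ⟪p, v⟫)) := by
  refine ⟨convex_univ, fun x _ y _ s t hs ht hst => ?_⟩
  have hpos : ∀ v : EE n, 0 < ∑ p ∈ Λ, a p * Real.exp (k * ⟪p, v⟫) :=
    fun v => Finset.sum_pos (fun p hp => mul_pos (ha p hp) (Real.exp_pos _)) hne
  set X := ∑ p ∈ Λ, a p * Real.exp (k * ⟪p, x⟫) with hX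
  set Y := ∑ p ∈ Λ, a p * Real.exp (k * ⟪p, y⟫) with hY
  have hXp : 0 < X := hpos x
  have hYp : 0 < Y := hpos y
  simp only [smul_eq_mul]
  rw [Real.log_le_iff_le_exp (hpos _)]
  have key : ∀ p ∈ Λ, a p * Real.exp (k * ⟪p, s • x + t • y⟫) ≤
      Real.exp (s * Real.log X + t * Real.log Y) *
        (s * (a p * Real.exp (k * ⟪p, x⟫) / X) + t * (a p * Real.exp (k * ⟪p, y⟫) / Y)) := by
    intro p hp
    have h := convexOn_exp.2 (Set.mem_univ (k * ⟪p, x⟫ - Real.log X)) (Set.mem_univ (k * ⟪p, y⟫ - Real.log Y)) hs ht hst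
    simp only [smul_eq_mul] at h
    rw [Real.exp_sub (k * ⟪p, x⟫), Real.exp_sub (k * ⟪p, y⟫), Real.exp_log hXp, Real.exp_log hYp] at h
    have e : Real.exp (k * ⟪p, s • x + t • y⟫) = Real.exp (s * Real.log X + t * Real.log Y) *
        Real.exp (s * (k * ⟪p, x⟫ - Real.log X) + t * (k * ⟪p, y⟫ - Real.log Y)) := by
      rw [← Real.exp_add, inner_add_right, inner_smul_right, inner_smul_right]
      congr 1; ring
    rw [e]
    have h2 := mul_le_mul_of_nonneg_left h (mul_nonneg (ha p hp).le (Real.exp_pos (s * Real.log X + t * Real.log Y)).le)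
    rw [← mul_assoc]
    refine h2.trans (le_of_eq ?_)
    ring
  refine (Finset.sum_le_sum key).trans (le_of_eq ?_)
  rw [← Finset.mul_sum, Finset.sum_add_distrib, ← Finset.mul_sum, ← Finset.mul_sum, ← Finset.sum_div,
    ← Finset.sum_div, div_self hXp.ne', div_self hYp.ne', mul_one, mul_one, hst, mul_one]

lemma part_a (A : Finset (EE n)) (hspan : affineSpan ℝ (A : Set (EE n)) = ⊤)
    (hLat : ∀ α ∈ A, ∀ i, ∃ m : ℤ, α i = (m : ℝ)) (χ : EE n → ℝ)
    (hχ : ContDiff ℝ (⊤ : ℕ∞) χ) (hc : HasCompactSupport χ) (M : ℝ) (hM : ∀ x, |χ x| ≤ M)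
    (φ : EE n → ℝ) (hφ : ∀ v, φ v = lse A v + χ v)
    (Λ : ℕ → Finset (EE n))
    (hΛ : ∀ k : ℕ, 1 ≤ k → ((Λ k : Set (EE n))
      = convexHull ℝ (A : Set (EE n)) ∩ {p | ∀ i, ∃ m : ℤ, p i = (m : ℝ) / (k : ℝ)}))
    (N : ℕ → EE n → ℝ)
    (hN : ∀ k p, N k p = ∫ w, Real.exp ((k : ℝ) * (⟪p, w⟫ - φ w)) * (Hf A w).det) :
    ∃ C > (0 : ℝ), ∀ k : ℕ, 1 ≤ k → ∀ v,
      ∑ p ∈ Λ k, Real.exp ((k : ℝ) * (⟪p, v⟫ - φ v)) / N k p ≤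
        C * (k : ℝ) ^ n * Real.exp (-(k : ℝ) * (φ v - convEnv φ v)) := by
  obtain rfl : φ = fun v => lse A v + χ v := funext hφ
  have hA := nonempty_of_span A hspan
  obtain ⟨C, hC, H⟩ := bound_all A hspan hLat χ hχ hc M hM Λ hΛ N hN
  refine ⟨C, hC, fun k hk v => ?_⟩
  have hk0 : (0 : ℝ) < k := by exact_mod_cast hk
  have hmem : ∀ p ∈ Λ k, p ∈ convexHull ℝ (A : Set (EE n)) := by
    intro p hp
    have : p ∈ (Λ k : Set (EE n)) := hp
    rw [hΛ k hk] at this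
    exact this.1
  have hne : (Λ k).Nonempty := by
    obtain ⟨α, hα⟩ := hA
    refine ⟨α, ?_⟩
    have : α ∈ (Λ k : Set (EE n)) := by
      rw [hΛ k hk]
      refine ⟨subset_convexHull ℝ _ hα, fun i => ?_⟩
      obtain ⟨m, hm⟩ := hLat α hα i
      exact ⟨m * k, by rw [hm]; push_cast; field_simp⟩
    exact this
  have hNp : ∀ p ∈ Λ k, 0 < (N k p)⁻¹ := by
    intro p hp
    rw [hN]
    exact inv_pos.2 (Nterm_pos A hspan χ hχ.continuous M hM k (hmem p hp))
  set K : EE n → ℝ := fun w => ∑ p ∈ Λ k, (N k p)⁻¹ * Real.exp (k * ⟪p, w⟫) with hK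
  have hKpos : ∀ w, 0 < K w := fun w => Finset.sum_pos (fun p hp => mul_pos (hNp p hp) (Real.exp_pos _)) hne
  have hBK : ∀ w, ∑ p ∈ Λ k, Real.exp ((k : ℝ) * (⟪p, w⟫ - (lse A w + χ w))) / N k p =
      K w * Real.exp (-(k * (lse A w + χ w))) := by
    intro w
    rw [hK, Finset.sum_mul]
    refine Finset.sum_congr rfl fun p _ => ?_
    rw [mul_assoc, ← Real.exp_add, div_eq_inv_mul]
    congr 2
    ring
  set T := C * (k : ℝ) ^ n with hT
  have hTpos : 0 < T := by positivity
  set g : EE n → ℝ := fun w => (1 / (k : ℝ)) * (Real.log (K w) + -Real.log T) with hg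
  have hgconv : ConvexOn ℝ Set.univ g := by
    have h1 := convexOn_log_sum (Λ k) hne (fun p => (N k p)⁻¹) hNp k
    have h2 := (h1.add (convexOn_const (-Real.log T) convex_univ)).smul (c := 1 / (k : ℝ)) (by positivity)
    exact h2
  have hgle : ∀ w, g w ≤ lse A w + χ w := by
    intro w
    have h1 := H k hk w
    rw [hBK, ← hT] at h1
    have h2 := Real.log_le_log (mul_pos (hKpos w) (Real.exp_pos _)) h1
    rw [Real.log_mul (hKpos w).ne' (Real.exp_pos _).ne', Real.log_exp] at h2
    simp only [hg]
    rw [one_div, inv_mul_le_iff₀ hk0]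
    linarith
  have hle : g v ≤ convEnv (fun v => lse A v + χ v) v := by
    apply le_csSup
    · refine ⟨lse A v + χ v, ?_⟩
      rintro _ ⟨g', _, h, rfl⟩
      exact h v
    · exact ⟨g, hgconv, hgle, rfl⟩
  simp only
  rw [hBK]
  set e := convEnv (fun v => lse A v + χ v) v with he
  have h3 : K v = T * Real.exp (k * g v) := by
    simp only [hg]
    rw [← mul_assoc, mul_one_div_cancel hk0.ne', one_mul, Real.exp_add, Real.exp_neg, Real.exp_log (hKpos v),
      Real.exp_log hTpos]
    field_simp
  rw [h3, mul_assoc, ← Real.exp_add]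
  apply mul_le_mul_of_nonneg_left _ hTpos.le
  apply Real.exp_le_exp.2
  have := mul_le_mul_of_nonneg_left hle hk0.le
  linarith

lemma main_aux (n : ℕ)
    (S : Finset (EuclideanSpace ℝ (Fin n)))
    (hS : ∀ α ∈ S, ∀ i, ∃ m : ℤ, α i = (m : ℝ))
    (Δ : Set (EuclideanSpace ℝ (Fin n)))
    (hΔ : Δ = convexHull ℝ (S : Set (EuclideanSpace ℝ (Fin n))))
    (hΔint : (interior Δ).Nonempty)
    (A : Finset (EuclideanSpace ℝ (Fin n)))
    (hA : (A : Set (EuclideanSpace ℝ (Fin n))) = Δ ∩ {v | ∀ i, ∃ m : ℤ, v i = (m : ℝ)})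
    (φΔ χ φ : EuclideanSpace ℝ (Fin n) → ℝ)
    (hφΔ : ∀ v, φΔ v = Real.log (∑ α ∈ A, Real.exp ⟪α, v⟫))
    (hχ : ContDiff ℝ (⊤ : ℕ∞) χ) (hχc : HasCompactSupport χ)
    (hφ : φ = φΔ + χ)
    (Λ : ℕ → Finset (EuclideanSpace ℝ (Fin n)))
    (hΛ : ∀ k : ℕ, 1 ≤ k → ((Λ k : Set (EuclideanSpace ℝ (Fin n)))
      = Δ ∩ {p | ∀ i, ∃ m : ℤ, p i = (m : ℝ) / (k : ℝ)}))
    (N : ℕ → EuclideanSpace ℝ (Fin n) → ℝ)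
    (hN : ∀ k p, N k p
      = ∫ w, Real.exp ((k : ℝ) * (⟪p, w⟫ - φ w)) * (fderiv ℝ (gradient φΔ) w).det)
    (B : ℕ → EuclideanSpace ℝ (Fin n) → ℝ)
    (hB : ∀ k v, B k v = ∑ p ∈ Λ k, Real.exp ((k : ℝ) * (⟪p, v⟫ - φ v)) / N k p) :
    (∃ C > (0 : ℝ), ∀ k : ℕ, 1 ≤ k → ∀ v,
      B k v ≤ C * (k : ℝ) ^ n * Real.exp (-(k : ℝ) * (φ v - convEnv φ v))) ∧
    (∀ Ω : Set (EuclideanSpace ℝ (Fin n)), IsCompact Ω →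
      ∃ C > (0 : ℝ), ∀ k : ℕ, 1 ≤ k → ∀ v ∈ Ω,
        C⁻¹ * Real.exp (-(k : ℝ) * (φ v - convEnv φ v)) ≤ B k v) := by
  obtain rfl : φΔ = lse A := funext hφΔ
  have hSA : (S : Set (EE n)) ⊆ A := by
    rw [hA, hΔ]
    exact fun α hα => ⟨subset_convexHull ℝ _ hα, hS α hα⟩
  have hAΔ : (A : Set (EE n)) ⊆ Δ := by rw [hA]; exact Set.inter_subset_left
  have hΔA : Δ = convexHull ℝ (A : Set (EE n)) := by
    apply Set.Subset.antisymm
    · rw [hΔ]; exact convexHull_mono hSA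
    · apply convexHull_min hAΔ
      rw [hΔ]; exact convex_convexHull ℝ _
  have hspan : affineSpan ℝ (A : Set (EE n)) = ⊤ := by
    rw [← interior_convexHull_nonempty_iff_affineSpan_eq_top, ← hΔA]; exact hΔint
  have hne := nonempty_of_span A hspan
  have hLat : ∀ α ∈ A, ∀ i, ∃ m : ℤ, α i = (m : ℝ) := by
    intro α hα
    have : α ∈ (A : Set (EE n)) := hα
    rw [hA] at this
    exact this.2
  obtain ⟨M, hM⟩ := hχc.exists_bound_of_continuous hχ.continuous
  have hM' : ∀ x, |χ x| ≤ M := hM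
  have hφ' : ∀ v, φ v = lse A v + χ v := fun v => by rw [hφ]; rfl
  have hN' : ∀ k p, N k p = ∫ w, Real.exp ((k : ℝ) * (⟪p, w⟫ - φ w)) * (Hf A w).det := by
    intro k p
    rw [hN]
    simp only [fderiv_gradient_lse hne]
  rw [hΔA] at hΛ
  constructor
  · obtain ⟨C, hC, h⟩ := part_a A hspan hLat χ hχ hχc M hM' φ hφ' Λ hΛ N hN'
    exact ⟨C, hC, fun k hk v => by rw [hB]; exact h k hk v⟩
  · intro Ω hΩ
    obtain ⟨C, hC, h⟩ := part_b A hspan hLat χ hχ.continuous M hM' φ hφ' Λ hΛ N hN' Ω hΩ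
    exact ⟨C, hC, fun k hk v hv => by rw [hB]; exact h k hk v hv⟩

end final_a

end

/-- toric model of the two-sided estimate
`e^{−k(φ−φ_e)} C_Ω^{−1} ≤ B_k ≤ C_Ω k^n e^{−k(φ−φ_e)}`. With `φ = φ_Δ + χ` as in the
toric setup and `B_k` the toric Bergman function: (a) there is `C > 0` with
`B_k(v) ≤ C k^n e^{−k(φ(v)−φ_e(v))}` for all `k ≥ 1` and all `v`; (b) for every compact
`Ω ⊂ ℝⁿ` there is `C_Ω > 0` with `B_k(v) ≥ C_Ω^{−1} e^{−k(φ(v)−φ_e(v))}` on `Ω`. -/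
theorem bergman_function_two_sided_estimate_toric (n : ℕ) (hn : 1 ≤ n)
    (S : Finset (EuclideanSpace ℝ (Fin n)))
    (hS : ∀ α ∈ S, ∀ i, ∃ m : ℤ, α i = (m : ℝ))
    (Δ : Set (EuclideanSpace ℝ (Fin n)))
    (hΔ : Δ = convexHull ℝ (S : Set (EuclideanSpace ℝ (Fin n))))
    (hΔint : (interior Δ).Nonempty)
    (A : Finset (EuclideanSpace ℝ (Fin n)))
    (hA : (A : Set (EuclideanSpace ℝ (Fin n))) = Δ ∩ {v | ∀ i, ∃ m : ℤ, v i = (m : ℝ)})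
    (φΔ χ φ : EuclideanSpace ℝ (Fin n) → ℝ)
    (hφΔ : ∀ v, φΔ v = Real.log (∑ α ∈ A, Real.exp ⟪α, v⟫))
    (hχ : ContDiff ℝ (⊤ : ℕ∞) χ) (hχc : HasCompactSupport χ)
    (hφ : φ = φΔ + χ)
    (Λ : ℕ → Finset (EuclideanSpace ℝ (Fin n)))
    (hΛ : ∀ k : ℕ, 1 ≤ k → ((Λ k : Set (EuclideanSpace ℝ (Fin n)))
      = Δ ∩ {p | ∀ i, ∃ m : ℤ, p i = (m : ℝ) / (k : ℝ)}))
    (N : ℕ → EuclideanSpace ℝ (Fin n) → ℝ)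
    (hN : ∀ k p, N k p
      = ∫ w, Real.exp ((k : ℝ) * (⟪p, w⟫ - φ w)) * (fderiv ℝ (gradient φΔ) w).det)
    (B : ℕ → EuclideanSpace ℝ (Fin n) → ℝ)
    (hB : ∀ k v, B k v = ∑ p ∈ Λ k, Real.exp ((k : ℝ) * (⟪p, v⟫ - φ v)) / N k p) :
    (∃ C > (0 : ℝ), ∀ k : ℕ, 1 ≤ k → ∀ v,
      B k v ≤ C * (k : ℝ) ^ n * Real.exp (-(k : ℝ) * (φ v - convEnv φ v))) ∧
    (∀ Ω : Set (EuclideanSpace ℝ (Fin n)), IsCompact Ω →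
      ∃ C > (0 : ℝ), ∀ k : ℕ, 1 ≤ k → ∀ v ∈ Ω,
        C⁻¹ * Real.exp (-(k : ℝ) * (φ v - convEnv φ v)) ≤ B k v) := by
  exact main_aux n S hS Δ hΔ hΔint A hA φΔ χ φ hφΔ hχ hχc hφ Λ hΛ N hN B hB
end
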